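/- arXiv:1011.2254 — 9 statements merged into one kernel-verified Lean document; each statement's English description precedes it below -/
import Mathlib

section
/- Chen–Louck interpolation (Theorem 4.1 of the paper): Let N ≥ 1 and 1 ≤ m ≤ N, and let Σ be a set of N distinct complex numbers. If f ∈ ℂ[x₁,…,x_m] is a symmetric polynomial whose degree in each individual variable x_i is at most N − m, then f = Σ_{Ω ⊆ Σ, |Ω| = m} f(Ω) · (∏_{i=1}^{m} ∏_{r ∈ Σ∖Ω} (x_i − r)) / (∏_{s ∈ Ω} ∏_{r ∈ Σ∖Ω} (s − r)), as an identity in ℂ[x₁,…,x_m]. -/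
open MvPolynomial

/-- An enumeration of the elements of a finite set of complex numbers (when `Ω.card = m`,
`enumFinset m Ω` lists the elements of `Ω`). -/
noncomputable def enumFinset (m : ℕ) (Ω : Finset ℂ) : Fin m → ℂ := fun i => Ω.toList.getD i 0

/-- A polynomial of degree at most `d` in each of its `m` variables vanishes if it vanishes at all
injective tuples from a set with more than `d + (m - 1)` elements. -/
theorem eq_zero_of_eval_injective_eq_zero {m d : ℕ} {S : Finset ℂ} (hS : d + (m - 1) < S.card)
    (g : MvPolynomial (Fin m) ℂ) (hdeg : ∀ i, g.degreeOf i ≤ d)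
    (hg : ∀ x : Fin m → ℂ, Function.Injective x → (∀ i, x i ∈ S) → eval x g = 0) :
    g = 0 := by
  set V : MvPolynomial (Fin m) ℂ :=
    (Matrix.vandermonde (X : Fin m → MvPolynomial (Fin m) ℂ)).det with hV
  have hV0 : V ≠ 0 := Matrix.det_vandermonde_ne_zero_iff.2 (X_injective)
  have hVdeg (k : Fin m) : V.degreeOf k ≤ m - 1 := by
    rw [hV, Matrix.det_apply]
    refine (degreeOf_sum_le _ _ _).trans (Finset.sup_le fun σ _ => ?_)
    have h : degreeOf k (∏ i, Matrix.vandermonde (X : Fin m → MvPolynomial (Fin m) ℂ) (σ i) i)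
        ≤ m - 1 := by
      refine (degreeOf_prod_le _ _ _).trans ?_
      rw [Finset.sum_eq_single (σ.symm k)]
      · rw [Matrix.vandermonde_apply, Equiv.apply_symm_apply]
        refine (degreeOf_pow_le _ _ _).trans ?_
        rw [degreeOf_X, if_pos rfl]
        have := (σ.symm k).isLt
        omega
      · intro i _ hi
        have hki : k ≠ σ i := fun h => hi (by simp [h])
        have := degreeOf_pow_le k (X (σ i) : MvPolynomial (Fin m) ℂ) i
        rw [degreeOf_X, if_neg hki] at this
        simpa [Matrix.vandermonde_apply] using this
      · simp
    rcases Int.units_eq_one_or (Equiv.Perm.sign σ) with hσ | hσ <;> rw [hσ]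
    · simpa using h
    · simpa [degreeOf_neg] using h
  have hprod : g * V = 0 := by
    refine eq_zero_of_eval_zero_at_prod_finset _ (fun _ => S) (fun i => ?_) fun x hx => ?_
    · exact ((degreeOf_mul_le _ _ _).trans (add_le_add (hdeg i) (hVdeg i))).trans_lt hS
    · rw [map_mul]
      by_cases hinj : Function.Injective x
      · rw [hg x hinj hx, zero_mul]
      · have : eval x V = (Matrix.vandermonde x).det := by
          rw [hV, RingHom.map_det]
          congr 1
          ext i j
          simp [Matrix.vandermonde_apply]
        rw [this, not_not.1 (mt Matrix.det_vandermonde_ne_zero_iff.1 hinj), mul_zero]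
  exact (mul_eq_zero.1 hprod).resolve_right hV0

theorem eval_eq_of_isSymmetric {m : ℕ} {f : MvPolynomial (Fin m) ℂ} (hsym : f.IsSymmetric)
    {x y : Fin m → ℂ} (hy : Function.Injective y) (hxy : ∀ i, y i ∈ Set.range x) :
    eval y f = eval x f := by
  choose σ hσ using hxy
  have hinj : Function.Injective σ := fun i j h => hy (by rw [← hσ i, ← hσ j, h])
  let e : Equiv.Perm (Fin m) := Equiv.ofBijective σ (Finite.injective_iff_bijective.1 hinj)
  have hye : y = x ∘ e := funext fun i => (hσ i).symm
  rw [hye, ← eval_rename, hsym e]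

theorem enumFinset_eq_getElem {m : ℕ} {Ω : Finset ℂ} (h : Ω.card = m) (i : Fin m) :
    enumFinset m Ω i = Ω.toList[i.1]'(by simp [h]) :=
  List.getD_eq_getElem _ _ _

theorem enumFinset_injective {m : ℕ} {Ω : Finset ℂ} (h : Ω.card = m) :
    Function.Injective (enumFinset m Ω) := fun i j hij => by
  rw [enumFinset_eq_getElem h, enumFinset_eq_getElem h] at hij
  exact Fin.ext ((Ω.nodup_toList.getElem_inj_iff).1 hij)

theorem enumFinset_mem {m : ℕ} {Ω : Finset ℂ} (h : Ω.card = m) (i : Fin m) :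
    enumFinset m Ω i ∈ Ω := by
  rw [enumFinset_eq_getElem h, ← Finset.mem_toList]
  exact List.getElem_mem _

theorem degreeOf_prod_X_sub_C_le {m : ℕ} (T : Finset ℂ) (k : Fin m) :
    degreeOf k (∏ i : Fin m, ∏ r ∈ T, (X i - C r : MvPolynomial (Fin m) ℂ)) ≤ T.card := by
  have h (i : Fin m) (r : ℂ) :
      degreeOf k (X i - C r : MvPolynomial (Fin m) ℂ) ≤ if k = i then 1 else 0 := by
    refine (degreeOf_sub_le _ _ _).trans ?_
    simp [degreeOf_X, degreeOf_C]
  calc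
    _ ≤ ∑ i : Fin m, ∑ r ∈ T, degreeOf k (X i - C r : MvPolynomial (Fin m) ℂ) :=
      (degreeOf_prod_le _ _ _).trans (Finset.sum_le_sum fun i _ => degreeOf_prod_le _ _ _)
    _ ≤ ∑ i : Fin m, ∑ r ∈ T, if k = i then 1 else 0 :=
      Finset.sum_le_sum fun i _ => Finset.sum_le_sum fun r _ => h i r
    _ = T.card := by simp

/-- **Chen–Louck interpolation**: a symmetric polynomial `f` in `m` variables whose degree in
each variable is at most `N - m` equals
`∑_{Ω ⊆ Σ, |Ω| = m} f(Ω) · (∏ᵢ ∏_{r ∈ Σ∖Ω} (xᵢ − r)) / (∏_{s ∈ Ω} ∏_{r ∈ Σ∖Ω} (s − r))`. -/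
theorem chen_louck_interpolation (N m : ℕ) (hN : 1 ≤ N) (hm : 1 ≤ m) (hmN : m ≤ N)
    (S : Finset ℂ) (hS : S.card = N)
    (f : MvPolynomial (Fin m) ℂ) (hsym : f.IsSymmetric)
    (hdeg : ∀ i : Fin m, f.degreeOf i ≤ N - m) :
    f = ∑ Ω ∈ S.powersetCard m,
        C (eval (enumFinset m Ω) f * (∏ s ∈ Ω, ∏ r ∈ S \ Ω, (s - r))⁻¹) *
          ∏ i : Fin m, ∏ r ∈ S \ Ω, (X i - C r) := by
  rw [← sub_eq_zero]
  refine eq_zero_of_eval_injective_eq_zero (d := N - m) (S := S) (by omega) _ (fun k => ?_)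
    fun x hx hxS => ?_
  · refine (degreeOf_sub_le _ _ _).trans (max_le (hdeg k) ?_)
    refine (degreeOf_sum_le _ _ _).trans (Finset.sup_le fun Ω hΩ => ?_)
    rw [Finset.mem_powersetCard] at hΩ
    refine (degreeOf_C_mul_le _ _ _).trans ((degreeOf_prod_X_sub_C_le _ _).trans ?_)
    rw [Finset.card_sdiff_of_subset hΩ.1, hS, hΩ.2]
  · have hcard : (Finset.univ.image x).card = m := by
      rw [Finset.card_image_of_injective _ hx, Finset.card_fin]
    have hsub : Finset.univ.image x ⊆ S := by
      simpa [Finset.image_subset_iff] using hxS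
    rw [map_sub, map_sum, Finset.sum_eq_single (Finset.univ.image x)]
    · have hf : eval (enumFinset m (Finset.univ.image x)) f = eval x f :=
        eval_eq_of_isSymmetric hsym (enumFinset_injective hcard) fun i => by
          simpa using enumFinset_mem hcard i
      have h0 : ∏ s ∈ Finset.univ.image x, ∏ r ∈ S \ Finset.univ.image x, (s - r) ≠ 0 :=
        Finset.prod_ne_zero_iff.2 fun s hs => Finset.prod_ne_zero_iff.2 fun r hr =>
          sub_ne_zero.2 fun h => (Finset.mem_sdiff.1 hr).2 (h ▸ hs)
      have hp : eval x (∏ i : Fin m, ∏ r ∈ S \ Finset.univ.image x, (X i - C r)) =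
          ∏ s ∈ Finset.univ.image x, ∏ r ∈ S \ Finset.univ.image x, (s - r) := by
        rw [Finset.prod_image hx.injOn]
        simp only [map_prod, map_sub, eval_X, eval_C]
      rw [map_mul, eval_C, hp, hf, inv_mul_cancel_right₀ h0, sub_self]
    · intro Ω hΩ hne
      rw [Finset.mem_powersetCard] at hΩ
      obtain ⟨i, hi⟩ : ∃ i, x i ∉ Ω := by
        by_contra! h
        refine hne (Finset.eq_of_subset_of_card_le ?_ (by rw [hcard, hΩ.2])).symm
        simpa [Finset.image_subset_iff] using h
      rw [map_mul, map_prod, Finset.prod_eq_zero (Finset.mem_univ i), mul_zero]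
      rw [map_prod]
      exact Finset.prod_eq_zero (Finset.mem_sdiff.2 ⟨hxS i, hi⟩) (by simp)
    · exact fun h => absurd (Finset.mem_powersetCard.2 ⟨hsub, hcard⟩) h
end

section
/- Let m ≥ 1 and let a, b ∈ ℂ with a ≠ 0. In ℂ[x₁,…,x_m,y₁,…,y_m], write X_k = e_k(x₁,…,x_m) and Y_k = e_k(y₁,…,y_m) for the k-th elementary symmetric polynomials, and write X̂_i = e_i(ax₁+b,…,ax_m+b) and Ŷ_i = e_i(ay₁+b,…,ay_m+b). Then for each 1 ≤ i ≤ m there exist polynomials g₁,…,g_{i−1}, where each g_j lies in the subring ℂ[X₁,…,X_{i−1},Y₁,…,Y_{i−1}] and has total degree at most i − j − 1 as a polynomial in x₁,…,x_m,y₁,…,y_m, such that X̂_i − Ŷ_i = a^i (X_i − Y_i) + Σ_{j=1}^{i−1} (X_j − Y_j)·g_j. -/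
open MvPolynomial

/-- `Xe m k` is the `k`-th elementary symmetric polynomial in the variables `x₁, …, x_m`
inside `ℂ[x₁,…,x_m,y₁,…,y_m]`. -/
noncomputable def Xe (m k : ℕ) : MvPolynomial (Fin m ⊕ Fin m) ℂ :=
  rename Sum.inl (esymm (Fin m) ℂ k)

/-- `Ye m k` is the `k`-th elementary symmetric polynomial in the variables `y₁, …, y_m`. -/
noncomputable def Ye (m k : ℕ) : MvPolynomial (Fin m ⊕ Fin m) ℂ :=
  rename Sum.inr (esymm (Fin m) ℂ k)

/-- `Xhat m a b k = e_k(a·x₁+b, …, a·x_m+b)`. -/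
noncomputable def Xhat (m : ℕ) (a b : ℂ) (k : ℕ) : MvPolynomial (Fin m ⊕ Fin m) ℂ :=
  aeval (fun j : Fin m => C a * X (Sum.inl j) + C b) (esymm (Fin m) ℂ k)

/-- `Yhat m a b k = e_k(a·y₁+b, …, a·y_m+b)`. -/
noncomputable def Yhat (m : ℕ) (a b : ℂ) (k : ℕ) : MvPolynomial (Fin m ⊕ Fin m) ℂ :=
  aeval (fun j : Fin m => C a * X (Sum.inr j) + C b) (esymm (Fin m) ℂ k)

/-- Elementary symmetric functions after an affine change of variables. -/
theorem Multiset.esymm_map_mul_add {R : Type*} [CommRing R] (s : Multiset R) (a b : R) {i : ℕ}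
    (hi : i ≤ s.card) :
    (s.map fun r => a * r + b).esymm i =
      ∑ j ∈ Finset.range (i + 1),
        a ^ j * b ^ (i - j) * ((s.card - j).choose (s.card - i) : R) * s.esymm j := by
  have hscale (j : ℕ) : (s.map fun r => a * r).esymm j = a ^ j * s.esymm j := by
    simpa [smul_eq_mul] using (Multiset.pow_smul_esymm a j s).symm
  have hcomp : ((s.map fun r => a * r + b).map fun r => Polynomial.X + Polynomial.C r).prod =
      ((s.map fun r => a * r).map fun r => Polynomial.X + Polynomial.C r).prod.comp
        (Polynomial.X + Polynomial.C b) := by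
    rw [Polynomial.multiset_prod_comp]
    simp only [Multiset.map_map, Function.comp_def, Polynomial.add_comp, Polynomial.X_comp,
      Polynomial.C_comp, Polynomial.C_add]
    congr 1
    exact Multiset.map_congr rfl fun r _ => by ring
  have hcoeff := congrArg (fun p => p.coeff (s.card - i)) hcomp
  simp only [Multiset.prod_X_add_C_eq_sum_esymm (s.map fun r => a * r), Multiset.card_map,
    hscale, Polynomial.sum_comp, Polynomial.mul_comp, Polynomial.C_comp,
    Polynomial.X_pow_comp, Polynomial.finsetSum_coeff, Polynomial.coeff_C_mul,
    Polynomial.coeff_X_add_C_pow] at hcoeff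
  rw [Multiset.prod_X_add_C_coeff _ (by simp), Multiset.card_map, Nat.sub_sub_self hi] at hcoeff
  rw [hcoeff]
  symm
  apply Finset.sum_subset_zero_on_sdiff
  · exact Finset.range_mono (by omega)
  · intro j hj
    simp only [Finset.mem_sdiff, Finset.mem_range] at hj
    rw [Nat.choose_eq_zero_of_lt (by omega)]
    simp
  · intro j hj
    rw [Finset.mem_range] at hj
    rw [show s.card - j - (s.card - i) = i - j by omega]
    ring

theorem MvPolynomial.aeval_affine_esymm {σ R S : Type*} [Fintype σ] [CommRing R] [CommRing S]
    [Algebra R S] (f : σ → S) (a b : S) {i : ℕ} (hi : i ≤ Fintype.card σ) :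
    aeval (fun j => a * f j + b) (esymm σ R i) =
      ∑ j ∈ Finset.range (i + 1),
        a ^ j * b ^ (i - j) * ((Fintype.card σ - j).choose (Fintype.card σ - i) : S) *
          aeval f (esymm σ R j) := by
  simp only [aeval_esymm_eq_multiset_esymm]
  simpa [Multiset.map_map, Function.comp_def] using
    Multiset.esymm_map_mul_add (Finset.univ.val.map f) a b (i := i) (by simpa using hi)

/-- For each `1 ≤ i ≤ m` there are polynomials `g_j ∈ ℂ[X₁,…,X_{i−1},Y₁,…,Y_{i−1}]`
of total degree at most `i − j − 1` (in the `x`'s and `y`'s) with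
`X̂_i − Ŷ_i = aⁱ (X_i − Y_i) + ∑_{j=1}^{i−1} (X_j − Y_j)·g_j`. -/
theorem twist_elementary_sym_poly (m : ℕ) (hm : 1 ≤ m) (a b : ℂ) (ha : a ≠ 0)
    (i : ℕ) (hi1 : 1 ≤ i) (him : i ≤ m) :
    ∃ g : ℕ → MvPolynomial (Fin m ⊕ Fin m) ℂ,
      (∀ j ∈ Finset.Ico 1 i,
        g j ∈ Algebra.adjoin ℂ
          ((fun k => Xe m k) '' Set.Icc 1 (i - 1) ∪ (fun k => Ye m k) '' Set.Icc 1 (i - 1))) ∧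
      (∀ j ∈ Finset.Ico 1 i, (g j).totalDegree ≤ i - j - 1) ∧
      Xhat m a b i - Yhat m a b i
        = C (a ^ i) * (Xe m i - Ye m i) + ∑ j ∈ Finset.Ico 1 i, (Xe m j - Ye m j) * g j := by
  refine ⟨fun j => C (a ^ j * b ^ (i - j) * ((m - j).choose (m - i) : ℂ)), fun j _ => ?_,
    fun j _ => ?_, ?_⟩
  · exact Subalgebra.algebraMap_mem _ _
  · rw [totalDegree_C]
    exact Nat.zero_le _
  · have him' : i ≤ Fintype.card (Fin m) := by simpa using him
    have hX : Xhat m a b i = _ :=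
      aeval_affine_esymm (R := ℂ) (fun j : Fin m => X (Sum.inl j)) (C a) (C b) him'
    have hY : Yhat m a b i = _ :=
      aeval_affine_esymm (R := ℂ) (fun j : Fin m => X (Sum.inr j)) (C a) (C b) him'
    have hXe (k : ℕ) : aeval (fun j : Fin m => X (Sum.inl j)) (esymm (Fin m) ℂ k) = Xe m k := by
      simp only [Xe, rename_eq_aeval, Function.comp_def]
    have hYe (k : ℕ) : aeval (fun j : Fin m => X (Sum.inr j)) (esymm (Fin m) ℂ k) = Ye m k := by
      simp only [Ye, rename_eq_aeval, Function.comp_def]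
    have hzero : Xe m 0 = Ye m 0 := by simp [Xe, Ye]
    simp only [hXe, hYe, Fintype.card_fin] at hX hY
    rw [hX, hY, ← Finset.sum_sub_distrib, Finset.sum_range_succ, Finset.range_eq_Ico,
      Finset.sum_eq_sum_Ico_succ_bot (by omega), hzero, sub_self, zero_add, add_comm]
    congr 1
    · simp [mul_sub]
    · refine Finset.sum_congr rfl fun j _ => ?_
      simp only [map_mul, map_pow, map_natCast]
      ring
end

section
/- Let 1 ≤ m ≤ N and let Σ be a multiset of N complex numbers. Then the quotient ring Sym / (h_{N+1−m}(X−Σ), h_{N+2−m}(X−Σ), …, h_N(X−Σ)) is a ℂ-vector space of dimension binom(N, m). -/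
set_option synthInstance.maxHeartbeats 1000000
set_option maxHeartbeats 1000000
open MvPolynomial

/-- The `k`-th complete homogeneous symmetric polynomial in `m` variables, as an element of the
subalgebra of symmetric polynomials. -/
noncomputable def hSymElt (m k : ℕ) : symmetricSubalgebra (Fin m) ℂ :=
  ⟨hsymm (Fin m) ℂ k, (mem_symmetricSubalgebra _).2 (hsymm_isSymmetric (Fin m) ℂ k)⟩

/-- `h_k(X−Σ) := ∑_{j=0}^{k} (−1)^j e_j(Σ)·h_{k−j}`, as an element of the algebra of symmetric
polynomials in `m` variables. -/
noncomputable def hXSElt (m : ℕ) (S : Multiset ℂ) (k : ℕ) : symmetricSubalgebra (Fin m) ℂ :=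
  ∑ j ∈ Finset.range (k + 1), ((-1 : ℂ) ^ j * S.esymm j) • hSymElt m (k - j)

section

open scoped Polynomial

universe u

/-- The algebra obtained from `A` by universally splitting `k` linear factors off a monic polynomial
`p` of degree `n` is free of rank `n (n - 1) ⋯ (n - k + 1)`. -/
theorem Polynomial.Monic.exists_universal_prod_X_sub_C_dvd (k : ℕ) :
    ∀ {A : Type u} [CommRing A] {p : A[X]} {n : ℕ}, p.Monic → p.natDegree = n → k ≤ n →
    ∃ (E : Type u) (_ : CommRing E) (_ : Algebra A E) (x : Fin k → E),
      (∏ i, (Polynomial.X - Polynomial.C (x i))) ∣ p.map (algebraMap A E) ∧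
      Nonempty (Module.Basis (Fin (n.descFactorial k)) A E) ∧
      (∀ (T : Type u) [CommRing T] (φ : A →+* T) (y : Fin k → T),
        (∏ i, (Polynomial.X - Polynomial.C (y i))) ∣ p.map φ →
        ∃ ψ : E →+* T, ψ.comp (algebraMap A E) = φ ∧ ∀ i, ψ (x i) = y i) ∧
      (∀ (T : Type u) [CommRing T] (f g : E →+* T),
        f.comp (algebraMap A E) = g.comp (algebraMap A E) → (∀ i, f (x i) = g (x i)) → f = g) := by
  induction k with
  | zero =>
    intro A _ p n hp hn hk
    refine ⟨A, inferInstance, inferInstance, Fin.elim0, by simp, ⟨?_⟩, ?_, ?_⟩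
    · exact (Module.Basis.singleton (Fin 1) A).reindex (finCongr (by simp))
    · intro T _ φ y _
      exact ⟨φ, by ext; simp, fun i => i.elim0⟩
    · intro T _ f g h _
      simpa using h
  | succ k ih =>
    intro A _ p n hp hn hk
    obtain ⟨n, rfl⟩ : ∃ n', n = n' + 1 := ⟨n - 1, by omega⟩
    have hpd : 0 < p.natDegree := by omega
    have : Nontrivial A := by
      by_contra h
      rw [not_nontrivial_iff_subsingleton] at h
      simp [Polynomial.natDegree_of_subsingleton] at hpd
    have b : Module.Basis (Fin (n + 1)) A (AdjoinRoot p) :=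
      (AdjoinRoot.powerBasis' hp).basis.reindex (finCongr (by simp [hn]))
    have : Nontrivial (AdjoinRoot p) := ⟨b 0, 0, b.ne_zero 0⟩
    obtain ⟨p', hp'⟩ := Polynomial.dvd_iff_isRoot.2 (AdjoinRoot.isRoot_root p)
    have hX := Polynomial.monic_X_sub_C (AdjoinRoot.root p)
    have hp'm : p'.Monic := hX.of_mul_monic_left (hp' ▸ hp.map _)
    have hp'n : p'.natDegree = n := by
      have := congrArg Polynomial.natDegree hp'
      rw [hp.natDegree_map, hX.natDegree_mul hp'm, Polynomial.natDegree_X_sub_C] at this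
      omega
    obtain ⟨E, _, _, x, hdvd, ⟨bE⟩, hlift, hext⟩ := ih hp'm hp'n (by omega)
    let _ : Algebra A E := ((algebraMap (AdjoinRoot p) E).comp (algebraMap A (AdjoinRoot p))).toAlgebra
    have : IsScalarTower A (AdjoinRoot p) E := IsScalarTower.of_algebraMap_eq fun _ => rfl
    refine ⟨E, inferInstance, inferInstance,
      Fin.cons (algebraMap _ E (AdjoinRoot.root p)) x, ?_, ⟨?_⟩, ?_, ?_⟩
    · have h : p.map (algebraMap A E) = (p.map (AdjoinRoot.of p)).map (algebraMap _ E) := by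
        rw [Polynomial.map_map]; rfl
      rw [Fin.prod_univ_succ, h, hp']
      simpa using mul_dvd_mul_left _ hdvd
    · exact (b.smulTower bE).reindex
        (finProdFinEquiv.trans (finCongr (Nat.succ_descFactorial_succ n k).symm))
    · intro T _ φ y hy
      rw [Fin.prod_univ_succ] at hy
      have hroot : p.eval₂ φ (y 0) = 0 := by
        rw [← Polynomial.eval_map]
        exact Polynomial.dvd_iff_isRoot.1 ((Dvd.intro _ rfl).trans hy)
      let χ := AdjoinRoot.lift φ (y 0) hroot
      have hχ : χ.comp (AdjoinRoot.of p) = φ := AdjoinRoot.lift_comp_of hroot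
      have hχr : χ (AdjoinRoot.root p) = y 0 := AdjoinRoot.lift_root hroot
      have hmap : p.map φ = (Polynomial.X - Polynomial.C (y 0)) * p'.map χ := by
        have := congrArg (Polynomial.map χ) hp'
        rw [Polynomial.map_map, hχ] at this
        simpa [hχr] using this
      have htail : (∏ i : Fin k, (Polynomial.X - Polynomial.C (y i.succ))) ∣ p'.map χ := by
        obtain ⟨c, hc⟩ := hy
        rw [hmap, mul_assoc] at hc
        exact ⟨c, (Polynomial.monic_X_sub_C (y 0)).isRegular.left hc⟩
      obtain ⟨ψ, hψ, hψx⟩ := hlift T χ (fun i => y i.succ) htail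
      refine ⟨ψ, ?_, fun i => ?_⟩
      · rw [← hχ, ← hψ]; rfl
      · refine Fin.cases ?_ (fun j => ?_) i
        · simpa [hχr] using RingHom.congr_fun hψ (AdjoinRoot.root p)
        · simpa using hψx j
    · intro T _ f g hfg hx
      refine hext T f g (AdjoinRoot.ringHom_ext hfg ?_) fun i => by simpa using hx i.succ
      simpa using hx 0

/-- Reversing coefficients turns divisibility of monic polynomials into the vanishing of
coefficients of a power series quotient. -/
theorem Polynomial.Monic.dvd_iff_coeff_eq_zero {T : Type*} [CommRing T] {Q P : T[X]}
    {H : PowerSeries T} {m N : ℕ} (hQ : Q.Monic) (hQm : Q.natDegree = m) (hP : P.natDegree ≤ N)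
    (hmN : m ≤ N) (hH : (Q.reflect m : PowerSeries T) * H = (P.reflect N : T[X])) :
    Q ∣ P ↔ ∀ k, N - m < k → k ≤ N → PowerSeries.coeff k H = 0 := by
  have hNm : m + (N - m) = N := by omega
  constructor
  · rintro ⟨R, rfl⟩ k hk _
    have hR : R.natDegree ≤ N - m := by
      rcases eq_or_ne R 0 with rfl | hR
      · simp
      · rw [hQ.natDegree_mul' hR] at hP
        omega
    have hu : IsUnit (Q.reflect m : PowerSeries T) := by
      rw [PowerSeries.isUnit_iff_constantCoeff, Polynomial.constantCoeff_coe,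
        Polynomial.coeff_reflect, Polynomial.revAt_zero, ← hQm, hQ.coeff_natDegree]
      exact isUnit_one
    have h2 := Polynomial.reflect_mul Q R hQm.le hR
    rw [hNm] at h2
    rw [h2, Polynomial.coe_mul] at hH
    rw [hu.mul_left_cancel hH, Polynomial.coeff_coe, Polynomial.coeff_reflect,
      Polynomial.revAt_eq_self_of_lt hk]
    exact Polynomial.coeff_eq_zero_of_natDegree_lt (by omega)
  · intro h
    set r := PowerSeries.trunc (N - m + 1) H with hr
    have hrd : r.natDegree ≤ N - m := Nat.lt_succ_iff.1 (PowerSeries.natDegree_trunc_lt H _)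
    have hqd : (Q.reflect m).natDegree ≤ m :=
      Polynomial.natDegree_reflect_le.trans (by simp [hQm])
    have hpd : (P.reflect N).natDegree ≤ N :=
      Polynomial.natDegree_reflect_le.trans (by simp [hP])
    have key : Q.reflect m * r = P.reflect N := by
      ext k
      rcases le_or_gt k N with hk | hk
      · rw [← Polynomial.coeff_coe (P.reflect N), ← hH, ← Polynomial.coeff_coe,
          Polynomial.coe_mul, PowerSeries.coeff_mul, PowerSeries.coeff_mul]
        refine Finset.sum_congr rfl fun ij hij => ?_
        rw [Finset.HasAntidiagonal.mem_antidiagonal] at hij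
        congr 1
        rw [Polynomial.coeff_coe, hr, PowerSeries.coeff_trunc]
        split_ifs with hlt
        · rfl
        · exact (h _ (by omega) (by omega)).symm
      · rw [Polynomial.coeff_eq_zero_of_natDegree_lt, Polynomial.coeff_eq_zero_of_natDegree_lt]
        · omega
        · exact (Polynomial.natDegree_mul_le_of_le hqd hrd).trans_lt (by omega)
    refine ⟨r.reflect (N - m), ?_⟩
    have h2 := Polynomial.reflect_mul (Q.reflect m) r hqd hrd
    rw [hNm, key] at h2
    simpa using h2

theorem Multiset.coeff_reflect_prod_X_sub_C {R : Type*} [CommRing R] (s : Multiset R) (k : ℕ) :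
    (Polynomial.reflect s.card (s.map fun a => Polynomial.X - Polynomial.C a).prod).coeff k =
      (-1) ^ k * s.esymm k := by
  nontriviality R
  rw [Polynomial.coeff_reflect]
  rcases le_or_gt k s.card with hk | hk
  · rw [Polynomial.revAt_le hk, Multiset.prod_X_sub_C_coeff s (Nat.sub_le _ _),
      Nat.sub_sub_self hk]
  · rw [Polynomial.revAt_eq_self_of_lt hk, Polynomial.coeff_eq_zero_of_natDegree_lt,
      Multiset.esymm, Multiset.powersetCard_eq_empty _ hk]
    · simp
    · rwa [Polynomial.natDegree_multiset_prod_X_sub_C_eq_card]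

theorem Polynomial.reflect_card_prod_X_sub_C {R ι : Type*} [CommRing R] (s : Finset ι) (x : ι → R) :
    Polynomial.reflect s.card (∏ i ∈ s, (Polynomial.X - Polynomial.C (x i))) =
      ∏ i ∈ s, (1 - Polynomial.C (x i) * Polynomial.X) := by
  classical
  nontriviality R
  induction s using Finset.induction_on with
  | empty => simp
  | insert i s hi ih =>
    rw [Finset.prod_insert hi, Finset.prod_insert hi, Finset.card_insert_of_notMem hi, add_comm,
      Polynomial.reflect_mul _ _ (Polynomial.natDegree_X_sub_C_le _)
        (Polynomial.natDegree_finsetProd_X_sub_C_eq_card _ _).le, ih]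
    simp [Polynomial.reflect_sub, Polynomial.reflect_C]

end

theorem MvPolynomial.hsymm_eq_sum_finsuppAntidiag (σ R : Type*) [Fintype σ] [DecidableEq σ]
    [CommSemiring R] (n : ℕ) :
    hsymm σ R n = ∑ l ∈ Finset.univ.finsuppAntidiag n, ∏ i, (X i : MvPolynomial σ R) ^ l i := by
  rw [hsymm]
  refine Finset.sum_bij (fun s _ => Multiset.toFinsupp s.1) (fun s _ => ?_) (fun s _ t _ h => ?_)
    (fun l hl => ?_) (fun s _ => ?_)
  · rw [Finset.mem_finsuppAntidiag]
    refine ⟨?_, Finset.subset_univ _⟩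
    have := Multiset.toFinsupp_sum_eq s.1
    rw [Finsupp.sum_fintype _ _ fun _ => rfl] at this
    exact this.trans s.2
  · exact Subtype.ext (Multiset.toFinsupp.injective h)
  · rw [Finset.mem_finsuppAntidiag] at hl
    refine ⟨⟨Multiset.toFinsupp.symm l, ?_⟩, Finset.mem_univ _, ?_⟩
    · rw [Multiset.toFinsupp_symm_apply, Finsupp.card_toMultiset,
        Finsupp.sum_fintype _ _ fun _ => rfl]
      exact hl.1
    · simp
  · rw [Finset.prod_multiset_map_count]
    refine Finset.prod_subset (Finset.subset_univ _) fun i _ hi => ?_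
    simp_all

theorem MvPolynomial.prod_one_sub_mul_mk_hsymm (σ R : Type*) [Fintype σ] [DecidableEq σ]
    [CommRing R] :
    (∏ i : σ, (1 - PowerSeries.C (X i : MvPolynomial σ R) * PowerSeries.X)) *
      PowerSeries.mk (hsymm σ R) = 1 := by
  have h : PowerSeries.mk (hsymm σ R) =
      ∏ i : σ, PowerSeries.mk fun k => (X i : MvPolynomial σ R) ^ k := by
    ext1 n
    rw [PowerSeries.coeff_prod, PowerSeries.coeff_mk, hsymm_eq_sum_finsuppAntidiag]
    simp
  rw [h, ← Finset.prod_mul_distrib]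
  refine Finset.prod_eq_one fun i _ => ?_
  ext1 n
  rcases n with _ | n
  · simp
  · rw [sub_mul, one_mul, map_sub, mul_assoc, PowerSeries.coeff_C_mul, PowerSeries.coeff_succ_X_mul]
    simp [pow_succ']

section

open scoped Polynomial

/-- The `k`-th elementary symmetric polynomial in `m` variables, as an element of the subalgebra of
symmetric polynomials. -/
noncomputable def eSymElt (m k : ℕ) : symmetricSubalgebra (Fin m) ℂ :=
  ⟨esymm (Fin m) ℂ k, (mem_symmetricSubalgebra _).2 (esymm_isSymmetric (Fin m) ℂ k)⟩

/-- The polynomial `∏ i, (t - x i)`, with coefficients in the subalgebra of symmetric polynomials. -/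
noncomputable def symmRootPoly (m : ℕ) : (symmetricSubalgebra (Fin m) ℂ)[X] :=
  ∑ j ∈ Finset.range (m + 1),
    (-1) ^ j * (Polynomial.C (eSymElt m j) * Polynomial.X ^ (m - j))

theorem map_val_symmRootPoly (m : ℕ) :
    (symmRootPoly m).map (symmetricSubalgebra (Fin m) ℂ).val.toRingHom =
      ∏ i, (Polynomial.X - Polynomial.C (X i : MvPolynomial (Fin m) ℂ)) := by
  have h := Multiset.prod_X_sub_X_eq_sum_esymm
    (Finset.univ.val.map (X : Fin m → MvPolynomial (Fin m) ℂ))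
  rw [Multiset.map_map, Multiset.card_map, Finset.card_val, Finset.card_univ, Fintype.card_fin,
    ← esymm_eq_multiset_esymm] at h
  rw [Finset.prod_eq_multiset_prod]
  refine Eq.trans ?_ h.symm
  simp [symmRootPoly, Polynomial.map_sum, eSymElt]

theorem monic_symmRootPoly (m : ℕ) : (symmRootPoly m).Monic := by
  refine Polynomial.monic_of_injective
    (f := (symmetricSubalgebra (Fin m) ℂ).val.toRingHom) Subtype.val_injective ?_
  rw [map_val_symmRootPoly]
  exact Polynomial.monic_prod_X_sub_C _ _

theorem natDegree_symmRootPoly (m : ℕ) : (symmRootPoly m).natDegree = m := by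
  rw [← Polynomial.natDegree_map_eq_of_injective
    (f := (symmetricSubalgebra (Fin m) ℂ).val.toRingHom) Subtype.val_injective,
    map_val_symmRootPoly, Polynomial.natDegree_finsetProd_X_sub_C_eq_card]
  simp

theorem reflect_symmRootPoly_mul_mk_hSymElt (m : ℕ) :
    ((symmRootPoly m).reflect m : PowerSeries (symmetricSubalgebra (Fin m) ℂ)) *
      PowerSeries.mk (hSymElt m) = 1 := by
  apply PowerSeries.map_injective (symmetricSubalgebra (Fin m) ℂ).val.toRingHom
    Subtype.val_injective
  rw [map_mul, map_one, ← MvPolynomial.prod_one_sub_mul_mk_hsymm (Fin m) ℂ]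
  have hh : PowerSeries.map (symmetricSubalgebra (Fin m) ℂ).val.toRingHom
      (PowerSeries.mk (hSymElt m)) = PowerSeries.mk (hsymm (Fin m) ℂ) := by
    ext1 k
    simp [hSymElt]
  rw [hh]
  congr 1
  rw [← Polynomial.polynomial_map_coe, ← Polynomial.reflect_map, map_val_symmRootPoly]
  have h := Polynomial.reflect_card_prod_X_sub_C Finset.univ
    (X : Fin m → MvPolynomial (Fin m) ℂ)
  rw [Finset.card_univ, Fintype.card_fin] at h
  rw [h, ← Polynomial.coeToPowerSeries.ringHom_apply, map_prod]
  simp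

theorem reflect_symmRootPoly_mul_mk_hXSElt (m : ℕ) (S : Multiset ℂ) :
    ((symmRootPoly m).reflect m : PowerSeries (symmetricSubalgebra (Fin m) ℂ)) *
      PowerSeries.mk (hXSElt m S) =
    (((S.map fun a => Polynomial.X - Polynomial.C a).prod.map (algebraMap ℂ _)).reflect S.card :
      (symmetricSubalgebra (Fin m) ℂ)[X]) := by
  have h : PowerSeries.mk (hXSElt m S) = PowerSeries.mk (hSymElt m) *
      (((S.map fun a => Polynomial.X - Polynomial.C a).prod.map (algebraMap ℂ _)).reflect S.card :
      (symmetricSubalgebra (Fin m) ℂ)[X]) := by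
    ext1 k
    rw [mul_comm, PowerSeries.coeff_mul, Finset.Nat.sum_antidiagonal_eq_sum_range_succ_mk,
      PowerSeries.coeff_mk, hXSElt]
    refine Finset.sum_congr rfl fun j _ => ?_
    rw [Polynomial.coeff_coe, Polynomial.reflect_map, Polynomial.coeff_map,
      Multiset.coeff_reflect_prod_X_sub_C, PowerSeries.coeff_mk, Algebra.smul_def]
  rw [h, ← mul_assoc, reflect_symmRootPoly_mul_mk_hSymElt, one_mul]

/-- A ring homomorphism out of the symmetric polynomials kills `h_k(X−Σ)` for `N - m < k ≤ N` if and
only if it makes the generic monic polynomial of degree `m` divide `∏_{a ∈ Σ} (t - a)`. -/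
theorem symmRootPoly_map_dvd_iff {T : Type*} [CommRing T] {m N : ℕ} (hmN : m ≤ N) {S : Multiset ℂ}
    (hS : S.card = N) (φ : symmetricSubalgebra (Fin m) ℂ →+* T) :
    (symmRootPoly m).map φ ∣
        (S.map fun a => Polynomial.X - Polynomial.C a).prod.map (φ.comp (algebraMap ℂ _)) ↔
      ∀ k, N - m < k → k ≤ N → φ (hXSElt m S k) = 0 := by
  subst hS
  nontriviality T
  have h := congrArg (PowerSeries.map φ) (reflect_symmRootPoly_mul_mk_hXSElt m S)
  rw [map_mul, ← Polynomial.polynomial_map_coe, ← Polynomial.polynomial_map_coe,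
    ← Polynomial.reflect_map, ← Polynomial.reflect_map, Polynomial.map_map] at h
  rw [((monic_symmRootPoly m).map φ).dvd_iff_coeff_eq_zero
    (((monic_symmRootPoly m).natDegree_map φ).trans (natDegree_symmRootPoly m)) ?_ hmN h]
  · simp
  · exact Polynomial.natDegree_map_le.trans
      (Polynomial.natDegree_multiset_prod_X_sub_C_eq_card S).le

theorem symmetricSubalgebra_ringHom_ext {T : Type*} [CommRing T] {m : ℕ}
    {f g : symmetricSubalgebra (Fin m) ℂ →+* T}
    (hC : f.comp (algebraMap ℂ _) = g.comp (algebraMap ℂ _))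
    (h : (symmRootPoly m).map f = (symmRootPoly m).map g) : f = g := by
  have he (i : Fin m) : f (eSymElt m (i + 1)) = g (eSymElt m (i + 1)) := by
    have hc : (symmRootPoly m).coeff (m - (i + 1)) = (-1) ^ (i + 1 : ℕ) * eSymElt m (i + 1) := by
      apply Subtype.val_injective
      have h1 := congrArg (fun p => Polynomial.coeff p (m - (i + 1))) (map_val_symmRootPoly m)
      have h2 := Multiset.prod_X_sub_C_coeff
        (Finset.univ.val.map (X : Fin m → MvPolynomial (Fin m) ℂ)) (k := m - (i + 1)) (by simp)
      rw [Multiset.map_map, Multiset.card_map, Finset.card_val, Finset.card_univ, Fintype.card_fin,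
        ← esymm_eq_multiset_esymm, Nat.sub_sub_self i.2] at h2
      have h3 := h1.trans h2
      rw [Polynomial.coeff_map] at h3
      simpa [eSymElt] using h3
    have h1 := congrArg (fun p => Polynomial.coeff p (m - (i + 1))) h
    simp only [Polynomial.coeff_map, hc, map_mul, map_pow, map_neg, map_one] at h1
    exact (isUnit_one.neg.pow _).mul_left_cancel h1
  let e := esymmAlgEquiv (Fin m) ℂ (Fintype.card_fin m)
  have hcomp : f.comp e.toRingEquiv.toRingHom = g.comp e.toRingEquiv.toRingHom := by
    refine MvPolynomial.ringHom_ext (fun r => ?_) fun i => ?_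
    · have : e (C r) = algebraMap ℂ _ r := e.commutes r
      simpa [this] using RingHom.congr_fun hC r
    · have : e (X i) = eSymElt m (i + 1) := by
        apply e.symm.injective
        rw [e.symm_apply_apply]
        exact (esymmAlgEquiv_symm_apply (σ := Fin m) (R := ℂ) (Fintype.card_fin m) i).symm
      simpa [this] using he i
  ext1 x
  obtain ⟨y, rfl⟩ := e.surjective x
  exact RingHom.congr_fun hcomp y

end

/-- A dimension shared by all surjective images with kernel `I` is the dimension of the quotient
by `I`. -/
theorem Ideal.finrank_quotient_eq_of_forall_surjective {k A : Type} [Field k] [CommRing A]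
    [Algebra k A] (I : Ideal A) (c : ℕ)
    (h : ∀ (B : Type) [CommRing B] [Algebra k B] (f : A →ₐ[k] B), Function.Surjective f →
      RingHom.ker (f : A →+* B) = I → Module.finrank k B = c) :
    Module.finrank k (A ⧸ I) = c :=
  h (A ⧸ I) (Ideal.Quotient.mkₐ k I) (Ideal.Quotient.mkₐ_surjective k I)
    (Ideal.Quotient.mkₐ_ker k I)

/-- A `ℂ`-algebra quotient of the symmetric polynomials in `m` variables with kernel generated by
`h_{N+1−m}(X−Σ), …, h_N(X−Σ)` has dimension `binom(N, m)`. -/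
theorem finrank_eq_choose_of_ker_eq_span {B : Type} [CommRing B] [Algebra ℂ B] {N m : ℕ}
    (hmN : m ≤ N) {S : Multiset ℂ} (hS : S.card = N) (f : symmetricSubalgebra (Fin m) ℂ →ₐ[ℂ] B)
    (hf : Function.Surjective f)
    (hker : RingHom.ker (f : symmetricSubalgebra (Fin m) ℂ →+* B) =
      Ideal.span ((fun k => hXSElt m S k) '' Set.Icc (N + 1 - m) N)) :
    Module.finrank ℂ B = N.choose m := by
  set P := (S.map fun a => Polynomial.X - Polynomial.C a).prod with hP
  have hPm : P.Monic := Polynomial.monic_multiset_prod_of_monic _ _ fun a _ =>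
    Polynomial.monic_X_sub_C a
  have hPN : P.natDegree = N := by
    rw [hP, Polynomial.natDegree_multiset_prod_X_sub_C_eq_card, hS]
  obtain ⟨π, hπf⟩ : ∃ π : symmetricSubalgebra (Fin m) ℂ →+* B, π = f := ⟨_, rfl⟩
  have hπs : Function.Surjective π := hπf ▸ hf
  have hπC : π.comp (algebraMap ℂ _) = algebraMap ℂ B := by
    ext r
    exact hπf ▸ f.commutes r
  have hπk : RingHom.ker π = Ideal.span ((fun k => hXSElt m S k) '' Set.Icc (N + 1 - m) N) :=
    hπf ▸ hker
  have hπ : (symmRootPoly m).map π ∣ P.map (π.comp (algebraMap ℂ _)) := by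
    refine (symmRootPoly_map_dvd_iff hmN hS π).2 fun k hk hkN => ?_
    rw [← RingHom.mem_ker, hπk]
    exact (Ideal.subset_span ⟨k, Set.mem_Icc.2 ⟨by omega, hkN⟩, rfl⟩)
  obtain ⟨E, _, _, x, hxP, ⟨bE⟩, hE, hEext⟩ :=
    hPm.exists_universal_prod_X_sub_C_dvd m hPN hmN
  have : Nontrivial E := by
    have : 0 < N.descFactorial m := Nat.descFactorial_pos.2 hmN
    exact ⟨bE ⟨0, this⟩, 0, bE.ne_zero _⟩
  let θ : symmetricSubalgebra (Fin m) ℂ →+* E :=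
    (aeval x : MvPolynomial (Fin m) ℂ →ₐ[ℂ] E).toRingHom.comp
      (symmetricSubalgebra (Fin m) ℂ).val.toRingHom
  have hθC : θ.comp (algebraMap ℂ _) = algebraMap ℂ E := by
    ext r
    exact (aeval x : MvPolynomial (Fin m) ℂ →ₐ[ℂ] E).commutes r
  have hθQ : (symmRootPoly m).map θ = ∏ i, (Polynomial.X - Polynomial.C (x i)) := by
    rw [← Polynomial.map_map, map_val_symmRootPoly, Polynomial.map_prod]
    simp
  have hθI : RingHom.ker π ≤ RingHom.ker θ := by
    have h := (symmRootPoly_map_dvd_iff hmN hS θ).1 (by rwa [hθQ, hθC])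
    rw [hπk, Ideal.span_le]
    rintro _ ⟨k, hk, rfl⟩
    rw [Set.mem_Icc] at hk
    exact h k (by omega) hk.2
  let φ : B →+* E := π.liftOfSurjective hπs ⟨θ, hθI⟩
  have hφ : φ.comp π = θ := π.liftOfRightInverse_comp _ _ ⟨θ, hθI⟩
  have : Nontrivial B := φ.domain_nontrivial
  have hQm : ((symmRootPoly m).map π).Monic := (monic_symmRootPoly m).map π
  have hQd : ((symmRootPoly m).map π).natDegree = m :=
    ((monic_symmRootPoly m).natDegree_map π).trans (natDegree_symmRootPoly m)
  obtain ⟨F, _, _, y, hyQ, ⟨bF⟩, hF, hFext⟩ :=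
    hQm.exists_universal_prod_X_sub_C_dvd m hQd le_rfl
  let _ : Algebra ℂ F :=
    ((algebraMap B F).comp (algebraMap ℂ B)).toAlgebra
  have : IsScalarTower ℂ B F :=
    IsScalarTower.of_algebraMap_eq fun _ => rfl
  have : Nontrivial F := by
    have : 0 < m.descFactorial m := Nat.descFactorial_pos.2 le_rfl
    exact ⟨bF ⟨0, this⟩, 0, bF.ne_zero _⟩
  have hyprod : ((symmRootPoly m).map π).map (algebraMap _ F) =
      ∏ i, (Polynomial.X - Polynomial.C (y i)) := by
    refine Polynomial.eq_of_monic_of_dvd_of_natDegree_le (Polynomial.monic_prod_X_sub_C _ _)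
      (hQm.map _) hyQ ?_
    rw [hQm.natDegree_map, hQd, Polynomial.natDegree_finsetProd_X_sub_C_eq_card]
    simp
  obtain ⟨α, hαC, hαx⟩ := hE F (algebraMap ℂ F) y (by
    rw [← hyprod]
    have := Polynomial.map_dvd (algebraMap B F) hπ
    rwa [hπC, Polynomial.map_map (algebraMap ℂ B)] at this)
  obtain ⟨β, hβφ, hβy⟩ := hF E φ x (by rw [Polynomial.map_map, hφ, hθQ])
  have hβC : β.comp (algebraMap ℂ F) = algebraMap ℂ E := by
    rw [← hθC, ← hφ, ← hβφ, RingHom.comp_assoc, hπC]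
    rfl
  have hβα : β.comp α = RingHom.id E := by
    refine hEext E _ _ ?_ fun i => by simp [hαx, hβy]
    rw [RingHom.comp_assoc, hαC, hβC, RingHom.id_comp]
  have hαβ : α.comp β = RingHom.id F := by
    refine hFext F _ _ ?_ fun i => by simp [hαx, hβy]
    rw [RingHom.comp_assoc, hβφ, RingHom.id_comp]
    rw [← RingHom.cancel_right hπs, RingHom.comp_assoc, hφ]
    refine symmetricSubalgebra_ringHom_ext ?_ ?_
    · rw [RingHom.comp_assoc, hθC, hαC, RingHom.comp_assoc, hπC]
      rfl
    · rw [← Polynomial.map_map, hθQ, Polynomial.map_prod, ← Polynomial.map_map, hyprod]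
      simp [hαx]
  let e : E ≃ₐ[ℂ] F := AlgEquiv.ofRingEquiv (f := RingEquiv.ofRingHom α β hαβ hβα)
    fun r => RingHom.congr_fun hαC r
  let g : F ≃ₗ[ℂ] (Fin (m.descFactorial m) → B) :=
    bF.equivFun.restrictScalars ℂ
  have : Module.Finite ℂ E := Module.Finite.of_basis bE
  have : Module.Finite ℂ (Fin (m.descFactorial m) → B) :=
    Module.Finite.equiv (e.toLinearEquiv.trans g)
  have : Module.Finite ℂ B :=
    Module.Finite.of_surjective
      (LinearMap.proj (R := ℂ) (φ := fun _ => B)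
        (⟨0, Nat.descFactorial_pos.2 le_rfl⟩ : Fin (m.descFactorial m)))
      (LinearMap.proj_surjective _)
  have hfin := (e.toLinearEquiv.trans g).finrank_eq
  rw [Module.finrank_eq_card_basis bE, Module.finrank_pi_fintype, Fintype.card_fin,
    Finset.sum_const, Finset.card_univ, Fintype.card_fin, Nat.descFactorial_self, smul_eq_mul,
    Nat.descFactorial_eq_factorial_mul_choose] at hfin
  exact (Nat.eq_of_mul_eq_mul_left m.factorial_pos hfin).symm

/-- The quotient of the ring of symmetric polynomials in `m` variables by the ideal generated by
`h_{N+1−m}(X−Σ), …, h_N(X−Σ)` has dimension `binom(N, m)` over `ℂ`. -/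
theorem quotient_dim_choose (N m : ℕ) (hm : 1 ≤ m) (hmN : m ≤ N)
    (S : Multiset ℂ) (hS : Multiset.card S = N) :
    Module.finrank ℂ
        (symmetricSubalgebra (Fin m) ℂ ⧸
          Ideal.span ((fun k => hXSElt m S k) '' Set.Icc (N + 1 - m) N))
      = N.choose m := by
  refine Ideal.finrank_quotient_eq_of_forall_surjective _ _ fun B _ _ f hf hker => ?_
  exact finrank_eq_choose_of_ker_eq_span hmN hS f hf hker
end

section
/- Let 1 ≤ m ≤ N, let Σ be a multiset of N complex numbers, and let R = Sym / (h_{N+1−m}(X−Σ), h_{N+2−m}(X−Σ), …, h_N(X−Σ)). Then there exists a ℂ-linear map ζ_Σ : R → ℂ such that for all partitions λ, μ ∈ Λ_{m,N−m}, ζ_Σ applied to the image of S_λ(X)·S_μ(X−Σ) in R equals 1 if μ = λᶜ and equals 0 otherwise, where for λ = (λ₁ ≥ … ≥ λ_m) ∈ Λ_{m,N−m} one sets λᶜ := (N−m−λ_m ≥ … ≥ N−m−λ₁). -/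
set_option synthInstance.maxHeartbeats 1000000
set_option maxHeartbeats 1000000

open MvPolynomial

/-- The `k`-th complete homogeneous symmetric polynomial in `m` variables, as an element of the
subalgebra of symmetric polynomials; `0` for negative index `k : ℤ`. -/
noncomputable def hSymEltZ (m : ℕ) (k : ℤ) : symmetricSubalgebra (Fin m) ℂ :=
  if 0 ≤ k then ⟨hsymm (Fin m) ℂ k.toNat,
    (mem_symmetricSubalgebra _).2 (hsymm_isSymmetric (Fin m) ℂ k.toNat)⟩ else 0

/-- `h_k(X−Σ) := ∑_{j=0}^{k} (−1)^j e_j(Σ)·h_{k−j}`, as an element of the algebra of symmetric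
polynomials in `m` variables; `0` for negative index `k : ℤ`. -/
noncomputable def hXSEltZ (m : ℕ) (S : Multiset ℂ) (k : ℤ) : symmetricSubalgebra (Fin m) ℂ :=
  if 0 ≤ k then
    ∑ j ∈ Finset.range (k.toNat + 1), ((-1 : ℂ) ^ j * S.esymm j) • hSymEltZ m (k - j)
  else 0

/-- The set `Λ_{m,n}` of partitions `λ₁ ≥ … ≥ λ_m ≥ 0` with `λ₁ ≤ n`. -/
def Lam (m n : ℕ) : Type := { l : Fin m → ℕ // Antitone l ∧ ∀ i, l i ≤ n }

/-- The Schur polynomial `S_λ(X)`, via the Jacobi–Trudi formula. -/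
noncomputable def schurX (m : ℕ) (l : Fin m → ℕ) : symmetricSubalgebra (Fin m) ℂ :=
  (Matrix.of fun i j : Fin m => hSymEltZ m ((l i : ℤ) - (i : ℕ) + (j : ℕ))).det

/-- The Schur polynomial `S_λ(X−Σ)`, via the Jacobi–Trudi formula. -/
noncomputable def schurXS (m : ℕ) (S : Multiset ℂ) (l : Fin m → ℕ) :
    symmetricSubalgebra (Fin m) ℂ :=
  (Matrix.of fun i j : Fin m => hXSEltZ m S ((l i : ℤ) - (i : ℕ) + (j : ℕ))).det

/-- `μ` is the complementary partition `λᶜ = (N−m−λ_m ≥ … ≥ N−m−λ₁)` of `λ` in `Λ_{m,N−m}`. -/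
def IsCompl' (N m : ℕ) (lam mu : Fin m → ℕ) : Prop :=
  ∀ i : Fin m, mu i = N - m - lam (Fin.rev i)

namespace ZetaAux

/-- The sequence `q_j = (-1)^j e_j(Σ)`. -/
noncomputable def signedEsymm (S : Multiset ℂ) (j : ℕ) : ℂ := (-1 : ℂ) ^ j * S.esymm j

lemma signedEsymm_zero (S : Multiset ℂ) : signedEsymm S 0 = 1 := by
  simp [signedEsymm, Multiset.esymm]

lemma signedEsymm_of_card_lt (S : Multiset ℂ) {j : ℕ} (hj : Multiset.card S < j) :
    signedEsymm S j = 0 := by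
  simp [signedEsymm, Multiset.esymm, Multiset.powersetCard_eq_empty _ hj]

/-- The polynomial `h_a(x - Σ)` in one variable `x`. -/
noncomputable def hPoly (S : Multiset ℂ) (a : ℕ) : Polynomial ℂ :=
  ∑ j ∈ Finset.range (a + 1), signedEsymm S j • Polynomial.X ^ (a - j)

lemma hPoly_zero (a : ℕ) : hPoly 0 a = Polynomial.X ^ a := by
  rw [hPoly, Finset.sum_eq_single 0]
  · simp [signedEsymm_zero]
  · intro j _ hj
    rw [signedEsymm_of_card_lt 0 (by simpa using Nat.pos_of_ne_zero hj), zero_smul]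
  · simp

/-- The generating series of the powers of the variable `x_i`. -/
noncomputable def geomSeries {m : ℕ} (i : Fin m) : PowerSeries (MvPolynomial (Fin m) ℂ) :=
  PowerSeries.mk fun n => X i ^ n

/-- The polynomial `∏_{l ≠ k} (1 - x_l t)` in `t`. -/
noncomputable def coPoly {m : ℕ} (k : Fin m) : Polynomial (MvPolynomial (Fin m) ℂ) :=
  ∏ l ∈ Finset.univ.erase k, (1 - Polynomial.C (X l) * Polynomial.X)

lemma natDegree_coPoly_lt {m : ℕ} (k : Fin m) : (coPoly k).natDegree < m := by
  have h : (coPoly k).natDegree ≤ ∑ l ∈ Finset.univ.erase k, 1 := by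
    refine (Polynomial.natDegree_prod_le _ _).trans (Finset.sum_le_sum fun l _ => ?_)
    refine (Polynomial.natDegree_sub_le _ _).trans ?_
    exact max_le (by simp) (Polynomial.natDegree_C_mul_le _ _ |>.trans Polynomial.natDegree_X_le)
  have hk := k.2
  simp at h
  omega

lemma mk_hsymm_eq_prod (m : ℕ) :
    PowerSeries.mk (fun n => hsymm (Fin m) ℂ n) = ∏ i : Fin m, geomSeries i := by
  ext1 n
  rw [PowerSeries.coeff_prod, PowerSeries.coeff_mk, hsymm]
  refine Finset.sum_bij' (fun s _ => Multiset.toFinsupp s.1)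
    (fun l hl => ⟨Finsupp.toMultiset l, ?_⟩) ?_ ?_ ?_ ?_ ?_
  · rw [Finset.mem_finsuppAntidiag] at hl
    rw [Finsupp.card_toMultiset, Finsupp.sum_fintype _ _ (fun _ => rfl)]
    exact hl.1
  · intro s _
    rw [Finset.mem_finsuppAntidiag]
    refine ⟨?_, by simp⟩
    refine Eq.trans ?_ ((Multiset.toFinsupp_sum_eq s.1).trans s.2)
    exact (Finsupp.sum_fintype (Multiset.toFinsupp s.1) (fun _ n => n) (fun _ => rfl)).symm
  · exact fun _ _ => Finset.mem_univ _
  · intro s _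
    apply Subtype.ext
    simp
  · intro l _
    simp
  · intro s _
    simp only [geomSeries, PowerSeries.coeff_mk, Multiset.toFinsupp_apply]
    exact Finset.prod_multiset_map_count _ _ |>.trans
      (Finset.prod_subset (Finset.subset_univ _) (by
        intro x _ hx
        rw [Multiset.mem_toFinset] at hx
        rw [Multiset.count_eq_zero_of_notMem hx, pow_zero]))

lemma geomSeries_mul {m : ℕ} (i : Fin m) :
    geomSeries i * (1 - PowerSeries.C (X i) * PowerSeries.X) = 1 := by
  ext1 n
  cases n with
  | zero => simp [geomSeries, mul_sub, ← mul_assoc]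
  | succ n =>
    rw [mul_sub, mul_one, ← mul_assoc, map_sub, PowerSeries.coeff_succ_mul_X,
      PowerSeries.coeff_mul_C]
    simp [geomSeries, PowerSeries.coeff_one, pow_succ]

lemma mk_hsymm_mul_coPoly {m : ℕ} (k : Fin m) :
    PowerSeries.mk (fun n => hsymm (Fin m) ℂ n) * (coPoly k : PowerSeries _) = geomSeries k := by
  have h : (coPoly k : PowerSeries (MvPolynomial (Fin m) ℂ)) =
      ∏ l ∈ Finset.univ.erase k, (1 - PowerSeries.C (X l) * PowerSeries.X) := by
    rw [coPoly, ← Polynomial.coeToPowerSeries.ringHom_apply, map_prod]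
    simp
  rw [mk_hsymm_eq_prod, h, ← Finset.mul_prod_erase Finset.univ _ (Finset.mem_univ k), mul_assoc,
    ← Finset.prod_mul_distrib, Finset.prod_congr rfl fun l _ => geomSeries_mul l]
  simp

/-- The generating series of the `h_k(X - Σ)`. -/
noncomputable def hSeries (m : ℕ) (S : Multiset ℂ) : PowerSeries (MvPolynomial (Fin m) ℂ) :=
  PowerSeries.mk (fun j => C (signedEsymm S j)) * PowerSeries.mk (fun n => hsymm (Fin m) ℂ n)

lemma coe_hXSEltZ_natCast (m : ℕ) (S : Multiset ℂ) (k : ℕ) :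
    (hXSEltZ m S (k : ℤ) : MvPolynomial (Fin m) ℂ) = PowerSeries.coeff k (hSeries m S) := by
  rw [hSeries, PowerSeries.coeff_mul, Finset.Nat.sum_antidiagonal_eq_sum_range_succ_mk, hXSEltZ,
    if_pos (Int.natCast_nonneg k), Int.toNat_natCast]
  push_cast
  refine Finset.sum_congr rfl fun j hj => ?_
  have hj' : j ≤ k := by simpa [Nat.lt_succ_iff] using hj
  rw [hSymEltZ, if_pos (by omega)]
  have : ((k : ℤ) - j).toNat = k - j := by omega
  simp [this, signedEsymm, MvPolynomial.smul_eq_C_mul]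

lemma coe_hXSEltZ_neg (m : ℕ) (S : Multiset ℂ) {k : ℤ} (hk : k < 0) :
    hXSEltZ m S k = 0 := by
  rw [hXSEltZ, if_neg (by omega)]

lemma hXSEltZ_zero_right (m : ℕ) (k : ℤ) : hXSEltZ m 0 k = hSymEltZ m k := by
  rw [hXSEltZ]
  split_ifs with h
  · rw [Finset.sum_eq_single 0]
    · simp [Multiset.esymm]
    · intro j _ hj
      have := signedEsymm_of_card_lt 0 (by simpa using Nat.pos_of_ne_zero hj)
      rw [signedEsymm] at this
      rw [this, zero_smul]
    · simp
  · rw [hSymEltZ, if_neg h]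

lemma schurX_eq_schurXS_zero (m : ℕ) (l : Fin m → ℕ) : schurX m l = schurXS m 0 l := by
  simp only [schurX, schurXS, hXSEltZ_zero_right]

lemma coeff_hSeries_mul_coPoly {m : ℕ} (S : Multiset ℂ) (k : Fin m) (a : ℕ) :
    PowerSeries.coeff a (hSeries m S * (coPoly k : PowerSeries _)) =
      Polynomial.aeval (X k) (hPoly S a) := by
  rw [hSeries, mul_assoc, mk_hsymm_mul_coPoly, PowerSeries.coeff_mul,
    Finset.Nat.sum_antidiagonal_eq_sum_range_succ_mk, hPoly, map_sum]
  refine Finset.sum_congr rfl fun j _ => ?_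
  simp [geomSeries, MvPolynomial.smul_eq_C_mul]

lemma sum_hXSEltZ_mul_coeff {m : ℕ} (S : Multiset ℂ) (k : Fin m) (a : ℕ) :
    ∑ j : Fin m, (hXSEltZ m S ((a : ℤ) - (j : ℕ)) : MvPolynomial (Fin m) ℂ) *
      (coPoly k).coeff j = Polynomial.aeval (X k) (hPoly S a) := by
  rw [← coeff_hSeries_mul_coPoly, mul_comm, PowerSeries.coeff_mul,
    Finset.Nat.sum_antidiagonal_eq_sum_range_succ_mk,
    Fin.sum_univ_eq_sum_range (fun j => (hXSEltZ m S ((a : ℤ) - j) : MvPolynomial (Fin m) ℂ) *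
      (coPoly k).coeff j) m]
  have h1 : ∀ j ∈ Finset.range (a + 1 + m), j ∉ Finset.range m →
      (hXSEltZ m S ((a : ℤ) - j) : MvPolynomial (Fin m) ℂ) * (coPoly k).coeff j = 0 := by
    intro j _ hj
    rw [Polynomial.coeff_eq_zero_of_natDegree_lt, mul_zero]
    have := natDegree_coPoly_lt k
    simp at hj
    omega
  have h2 : ∀ j ∈ Finset.range (a + 1 + m), j ∉ Finset.range (a + 1) →
      (hXSEltZ m S ((a : ℤ) - j) : MvPolynomial (Fin m) ℂ) * (coPoly k).coeff j = 0 := by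
    intro j _ hj
    simp at hj
    rw [coe_hXSEltZ_neg _ _ (by omega)]
    simp
  rw [Finset.sum_subset (Finset.range_mono (by omega)) h1,
    ← Finset.sum_subset (Finset.range_mono (by omega)) h2]
  refine Finset.sum_congr rfl fun j hj => ?_
  have hj' : j ≤ a := by simpa [Nat.lt_succ_iff] using hj
  rw [← Nat.cast_sub hj', coe_hXSEltZ_natCast, mul_comm, Polynomial.coeff_coe]

/-- The determinant of the coefficients of the polynomials `∏_{l ≠ k} (1 - x_l t)`,
the Vandermonde determinant. -/
noncomputable def vdm (m : ℕ) : MvPolynomial (Fin m) ℂ :=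
  (Matrix.of fun j k : Fin m => (coPoly k).coeff (Fin.rev j : Fin m)).det

/-- The bialternant formula. -/
lemma coe_schurXS_mul_vdm {m : ℕ} (S : Multiset ℂ) (l : Fin m → ℕ) :
    (schurXS m S l : MvPolynomial (Fin m) ℂ) * vdm m =
      (Matrix.of fun i k : Fin m =>
        Polynomial.aeval (X k : MvPolynomial (Fin m) ℂ) (hPoly S (l i + Fin.rev i))).det := by
  have h := RingHom.map_det (symmetricSubalgebra (Fin m) ℂ).val.toRingHom
    (Matrix.of fun i j : Fin m => hXSEltZ m S ((l i : ℤ) - (i : ℕ) + (j : ℕ)))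
  change (schurXS m S l : MvPolynomial (Fin m) ℂ) = _ at h
  rw [h, vdm, ← Matrix.det_mul]
  congr 1
  ext1 i k
  rw [Matrix.mul_apply, Matrix.of_apply, ← sum_hXSEltZ_mul_coeff, ← Equiv.sum_comp Fin.revPerm]
  refine Finset.sum_congr rfl fun j _ => ?_
  have e : (l i : ℤ) - (i : ℕ) + ((Fin.rev j : Fin m) : ℕ) =
      ((l i + (Fin.rev i : Fin m) : ℕ) : ℤ) - (j : ℕ) := by
    have := i.2
    have := j.2
    simp only [Fin.val_rev]
    omega
  simp only [Matrix.of_apply, Fin.revPerm_apply, Fin.rev_rev, AlgHom.toRingHom_eq_coe,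
    RingHom.mapMatrix_apply, Matrix.map_apply]
  rw [← e]
  rfl

lemma schurXS_single {m : ℕ} (hm : 1 ≤ m) (S : Multiset ℂ) (k : ℕ) :
    schurXS m S (Pi.single ⟨0, hm⟩ k) = hXSEltZ m S k := by
  have h0 : hXSEltZ m S 0 = 1 := by
    apply Subtype.ext
    have := coe_hXSEltZ_natCast m S 0
    simpa [hSeries, signedEsymm_zero] using this
  rw [schurXS, Matrix.det_of_isUpperTriangular]
  · rw [Finset.prod_eq_single ⟨0, hm⟩]
    · simp
    · intro i _ hi
      simp [Pi.single_eq_of_ne hi, h0]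
    · simp
  · intro i j hij
    have hij' : (j : ℕ) < i := hij
    have hi : i ≠ ⟨0, hm⟩ := by
      rintro rfl
      simp at hij'
    rw [Matrix.of_apply, Pi.single_eq_of_ne hi, coe_hXSEltZ_neg _ _ (by push_cast; omega)]

/-- The coefficients at infinity of the inverse of `∏_{s ∈ Σ} (x - s)`. -/
noncomputable def residueSeq (S : Multiset ℂ) (k : ℕ) : ℂ :=
  PowerSeries.coeff (k + 1)
    (PowerSeries.X ^ (Multiset.card S) * (PowerSeries.mk (signedEsymm S))⁻¹)

/-- The residue functional `f ↦ -Res_{x = ∞} f(x) / ∏_{s ∈ Σ} (x - s)`. -/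
noncomputable def residue (S : Multiset ℂ) : Polynomial ℂ →ₗ[ℂ] ℂ :=
  (Polynomial.basisMonomials ℂ).constr ℂ (residueSeq S)

lemma residue_X_pow (S : Multiset ℂ) (a : ℕ) : residue S (Polynomial.X ^ a) = residueSeq S a := by
  rw [residue, ← Module.Basis.constr_basis (Polynomial.basisMonomials ℂ) ℂ (residueSeq S) a,
    Polynomial.coe_basisMonomials, Polynomial.X_pow_eq_monomial]

lemma residue_X_pow_mul_hPoly (S : Multiset ℂ) (hS : 1 ≤ Multiset.card S) (a b : ℕ)
    (hab : a < Multiset.card S ∨ Multiset.card S ≤ b) :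
    residue S (Polynomial.X ^ a * hPoly S b) = if a + b + 1 = Multiset.card S then 1 else 0 := by
  set N := Multiset.card S
  set Q := PowerSeries.mk (signedEsymm S) with hQ
  have hQ0 : PowerSeries.constantCoeff Q ≠ 0 := by
    rw [← PowerSeries.coeff_zero_eq_constantCoeff_apply, hQ, PowerSeries.coeff_mk,
      signedEsymm_zero]
    exact one_ne_zero
  have key : PowerSeries.coeff (a + b + 1) (Q * (PowerSeries.X ^ N * Q⁻¹)) =
      if a + b + 1 = N then 1 else 0 := by
    rw [mul_left_comm, PowerSeries.mul_inv_cancel _ hQ0, mul_one, PowerSeries.coeff_X_pow]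
  rw [← key, PowerSeries.coeff_mul, Finset.Nat.sum_antidiagonal_eq_sum_range_succ_mk, hPoly,
    Finset.mul_sum, map_sum]
  have hsub : Finset.range (b + 1) ⊆ Finset.range (a + b + 1 + 1) :=
    Finset.range_mono (by omega)
  rw [← Finset.sum_subset hsub]
  · refine Finset.sum_congr rfl fun j hj => ?_
    have hj' : j ≤ b := by simpa [Nat.lt_succ_iff] using hj
    rw [mul_smul_comm, map_smul, ← pow_add, residue_X_pow, residueSeq, smul_eq_mul, hQ,
      PowerSeries.coeff_mk]
    congr 3
    omega
  · intro j _ hj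
    have hj' : b + 1 ≤ j := by simpa using hj
    rcases hab with h | h
    · rw [PowerSeries.coeff_X_pow_mul', if_neg (by omega), mul_zero]
    · rw [hQ, PowerSeries.coeff_mk, signedEsymm_of_card_lt S (show N < j by omega), zero_mul]

/-- The tensor power of the residue functional. -/
noncomputable def multiResidue (m : ℕ) (S : Multiset ℂ) : MvPolynomial (Fin m) ℂ →ₗ[ℂ] ℂ :=
  (basisMonomials (Fin m) ℂ).constr ℂ fun α => ∏ i, residueSeq S (α i)

lemma multiResidue_prod {m : ℕ} (S : Multiset ℂ) (f : Fin m → Polynomial ℂ) :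
    multiResidue m S (∏ k, Polynomial.aeval (X k : MvPolynomial (Fin m) ℂ) (f k)) =
      ∏ k, residue S (f k) := by
  have h : (multiResidue m S).compMultilinearMap
      ((MultilinearMap.mkPiAlgebra ℂ (Fin m) (MvPolynomial (Fin m) ℂ)).compLinearMap
        fun k => (Polynomial.aeval (X k : MvPolynomial (Fin m) ℂ)).toLinearMap) =
      (MultilinearMap.mkPiAlgebra ℂ (Fin m) ℂ).compLinearMap fun _ => residue S := by
    refine Module.Basis.ext_multilinear (fun _ => Polynomial.basisMonomials ℂ) fun v => ?_
    simp only [LinearMap.compMultilinearMap_apply, MultilinearMap.compLinearMap_apply,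
      MultilinearMap.mkPiAlgebra_apply, Polynomial.coe_basisMonomials,
      ← Polynomial.X_pow_eq_monomial, residue_X_pow, AlgHom.toLinearMap_apply, map_pow,
      Polynomial.aeval_X]
    have hv : ∏ k, (X k : MvPolynomial (Fin m) ℂ) ^ v k =
        basisMonomials (Fin m) ℂ (Finsupp.equivFunOnFinite.symm v) := by
      rw [coe_basisMonomials]
      dsimp only
      rw [monomial_eq, Finsupp.prod_fintype _ _ (by simp)]
      simp
    rw [hv, multiResidue, Module.Basis.constr_basis]
    simp
  exact congrArg (fun M => M f) h

/-- Andréief's identity for the residue functional. -/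
lemma multiResidue_det_mul_det {m : ℕ} (S : Multiset ℂ) (A B : Fin m → Polynomial ℂ) :
    multiResidue m S
      ((Matrix.of fun i k : Fin m => Polynomial.aeval (X k : MvPolynomial (Fin m) ℂ) (A i)).det *
       (Matrix.of fun i k : Fin m => Polynomial.aeval (X k : MvPolynomial (Fin m) ℂ) (B i)).det) =
      (m.factorial : ℂ) * (Matrix.of fun i j : Fin m => residue S (A i * B j)).det := by
  set M : Matrix (Fin m) (Fin m) ℂ := Matrix.of fun i j : Fin m => residue S (A i * B j)
  have hterm : ∀ σ : Equiv.Perm (Fin m), ∑ τ : Equiv.Perm (Fin m),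
      ((Equiv.Perm.sign σ : ℤ) : ℂ) * (((Equiv.Perm.sign τ : ℤ) : ℂ) * ∏ k, M (σ k) (τ k)) =
      M.det := by
    intro σ
    have h := Matrix.det_permute σ M
    rw [← Matrix.det_transpose, Matrix.det_apply'] at h
    simp only [Matrix.transpose_apply, Matrix.submatrix_apply, id] at h
    rw [← Finset.mul_sum, h, ← mul_assoc, ← Int.cast_mul, ← Units.val_mul, Int.units_mul_self]
    simp
  rw [Matrix.det_apply', Matrix.det_apply', Finset.sum_mul_sum, map_sum]
  simp_rw [map_sum]
  calc _ = ∑ σ : Equiv.Perm (Fin m), ∑ τ : Equiv.Perm (Fin m),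
      ((Equiv.Perm.sign σ : ℤ) : ℂ) * (((Equiv.Perm.sign τ : ℤ) : ℂ) * ∏ k, M (σ k) (τ k)) := by
        refine Finset.sum_congr rfl fun σ _ => Finset.sum_congr rfl fun τ _ => ?_
        have e := multiResidue_prod S fun k => A (σ k) * B (τ k)
        simp only [map_mul, Finset.prod_mul_distrib] at e
        simp only [Matrix.of_apply, M]
        rw [← e, ← mul_assoc _ _ (multiResidue m S _), ← smul_eq_mul _ (multiResidue m S _),
          ← map_smul, smul_eq_C_mul]
        congr 1
        simp only [map_mul, map_intCast]
        ring
    _ = _ := by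
        rw [Finset.sum_congr rfl fun σ _ => hterm σ]
        simp [Fintype.card_perm]

/-- The residue functional kills products with an alternant that involves `h_a(x - Σ)`
with `a ≥ |Σ|`. -/
lemma multiResidue_mul_det_eq_zero {m : ℕ} (S : Multiset ℂ) (hS : 1 ≤ Multiset.card S)
    (F : MvPolynomial (Fin m) ℂ) (r : Fin m → ℕ) (i : Fin m) (hi : Multiset.card S ≤ r i) :
    multiResidue m S (F * (Matrix.of fun i k : Fin m =>
      Polynomial.aeval (X k : MvPolynomial (Fin m) ℂ) (hPoly S (r i))).det) = 0 := by
  induction F using MvPolynomial.induction_on' with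
  | add p q hp hq => rw [add_mul, map_add, hp, hq, add_zero]
  | monomial u a =>
    rw [Matrix.det_apply', Finset.mul_sum, map_sum]
    refine Finset.sum_eq_zero fun τ _ => ?_
    have e := multiResidue_prod S fun k => Polynomial.X ^ u k * hPoly S (r (τ k))
    rw [Finset.prod_eq_zero (f := fun k => residue S (Polynomial.X ^ u k * hPoly S (r (τ k))))
      (Finset.mem_univ (τ⁻¹ i))] at e
    · simp only [map_mul, map_pow, Polynomial.aeval_X, Finset.prod_mul_distrib] at e
      have hm : (monomial u a : MvPolynomial (Fin m) ℂ) = C a * ∏ k, X k ^ u k := by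
        rw [monomial_eq, Finsupp.prod_fintype _ _ (by simp)]
      have hC : (((Equiv.Perm.sign τ : ℤ) : MvPolynomial (Fin m) ℂ)) =
          C (((Equiv.Perm.sign τ : ℤ) : ℂ)) := by simp
      change multiResidue m S (_ * (_ * ∏ k, Polynomial.aeval (X k) (hPoly S (r (τ k))))) = 0
      rw [hm, hC, mul_mul_mul_comm, ← C_mul, ← smul_eq_C_mul, map_smul, e, smul_zero]
    · rw [residue_X_pow_mul_hPoly S hS _ _ (Or.inr (by simpa using hi)), if_neg]
      have hi' : Multiset.card S ≤ r (τ (τ⁻¹ i)) := by simpa using hi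
      omega

/-- The unnormalised trace `f ↦ Res (vdm² f)` on symmetric polynomials. -/
noncomputable def preTrace (m : ℕ) (S : Multiset ℂ) : symmetricSubalgebra (Fin m) ℂ →ₗ[ℂ] ℂ :=
  multiResidue m S ∘ₗ LinearMap.mulRight ℂ (vdm m * vdm m) ∘ₗ
    (symmetricSubalgebra (Fin m) ℂ).val.toLinearMap

lemma preTrace_apply (m : ℕ) (S : Multiset ℂ) (f : symmetricSubalgebra (Fin m) ℂ) :
    preTrace m S f = multiResidue m S ((f : MvPolynomial (Fin m) ℂ) * (vdm m * vdm m)) := rfl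

lemma preTrace_mul_hXSEltZ {m : ℕ} (hm : 1 ≤ m) (S : Multiset ℂ) (hS : 1 ≤ Multiset.card S)
    (f : symmetricSubalgebra (Fin m) ℂ) (k : ℕ) (hk : Multiset.card S + 1 - m ≤ k) :
    preTrace m S (f * hXSEltZ m S k) = 0 := by
  have h := coe_schurXS_mul_vdm S (Pi.single ⟨0, hm⟩ k)
  rw [schurXS_single hm] at h
  rw [preTrace_apply, MulMemClass.coe_mul, mul_assoc, mul_left_comm _ (vdm m) (vdm m), h,
    ← mul_assoc]
  refine multiResidue_mul_det_eq_zero S hS _ _ ⟨0, hm⟩ ?_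
  simp only [Pi.single_eq_same, Fin.val_rev]
  omega

lemma span_le_ker_preTrace {m : ℕ} (hm : 1 ≤ m) (S : Multiset ℂ) (hS : 1 ≤ Multiset.card S) :
    (Ideal.span ((fun k : ℕ => hXSEltZ m S (k : ℤ)) ''
      Set.Icc (Multiset.card S + 1 - m) (Multiset.card S))).restrictScalars ℂ ≤
        LinearMap.ker (preTrace m S) := by
  intro x hx
  rw [Submodule.restrictScalars_mem] at hx
  suffices h : ∀ f, preTrace m S (f * x) = 0 by simpa using h 1
  induction hx using Submodule.span_induction with
  | mem x hx =>
    obtain ⟨k, hk, rfl⟩ := hx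
    exact fun f => preTrace_mul_hXSEltZ hm S hS f k hk.1
  | zero => simp
  | add x y _ _ hx hy => intro f; rw [mul_add, map_add, hx, hy, add_zero]
  | smul a x _ hx => intro f; rw [smul_eq_mul, ← mul_assoc]; exact hx _

lemma preTrace_schurX_mul_schurXS {m : ℕ} (S : Multiset ℂ) (l r : Fin m → ℕ)
    (hS : 1 ≤ Multiset.card S) (hl : ∀ i, l i + Fin.rev i < Multiset.card S) :
    preTrace m S (schurX m l * schurXS m S r) = (m.factorial : ℂ) *
      (Matrix.of fun i j : Fin m => if (l i + Fin.rev i) + (r j + Fin.rev j) + 1 =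
        Multiset.card S then (1 : ℂ) else 0).det := by
  rw [preTrace_apply, MulMemClass.coe_mul, mul_mul_mul_comm, schurX_eq_schurXS_zero,
    coe_schurXS_mul_vdm, coe_schurXS_mul_vdm, multiResidue_det_mul_det]
  congr 3
  ext1 i
  funext j
  rw [hPoly_zero, residue_X_pow_mul_hPoly S hS _ _ (Or.inl (hl i))]

end ZetaAux

/-- There is a `ℂ`-linear map `ζ_Σ : Sym/(h_{N+1−m}(X−Σ),…,h_N(X−Σ)) → ℂ` with
`ζ_Σ(S_λ(X)·S_μ(X−Σ)) = 1` if `μ = λᶜ` and `= 0` otherwise, for `λ, μ ∈ Λ_{m,N−m}`. -/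
theorem zeta_exists (N m : ℕ) (hm : 1 ≤ m) (hmN : m ≤ N)
    (S : Multiset ℂ) (hS : Multiset.card S = N) :
    ∃ ζ : (symmetricSubalgebra (Fin m) ℂ ⧸
        Ideal.span ((fun k : ℕ => hXSEltZ m S (k : ℤ)) '' Set.Icc (N + 1 - m) N)) →ₗ[ℂ] ℂ,
      ∀ lam mu : Lam m (N - m),
        (IsCompl' N m lam.1 mu.1 →
          ζ (Ideal.Quotient.mk
            (Ideal.span ((fun k : ℕ => hXSEltZ m S (k : ℤ)) '' Set.Icc (N + 1 - m) N))
            (schurX m lam.1 * schurXS m S mu.1)) = 1) ∧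
        (¬ IsCompl' N m lam.1 mu.1 →
          ζ (Ideal.Quotient.mk
            (Ideal.span ((fun k : ℕ => hXSEltZ m S (k : ℤ)) '' Set.Icc (N + 1 - m) N))
            (schurX m lam.1 * schurXS m S mu.1)) = 0) := by
  subst hS
  have hS : 1 ≤ Multiset.card S := hm.trans hmN
  set N := Multiset.card S with hN
  set I := Ideal.span ((fun k : ℕ => hXSEltZ m S (k : ℤ)) '' Set.Icc (N + 1 - m) N)
  set c : ℂ := (m.factorial : ℂ) * (Matrix.of fun i j : Fin m =>
    if j = Fin.rev i then (1 : ℂ) else 0).det with hc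
  have hc0 : c ≠ 0 := by
    have h : (Matrix.of fun i j : Fin m => if j = Fin.rev i then (1 : ℂ) else 0) =
        (Fin.revPerm : Equiv.Perm (Fin m)).permMatrix ℂ := by
      ext i j
      simp [Equiv.Perm.permMatrix, PEquiv.toMatrix_apply, eq_comm]
    rw [hc, h, Matrix.det_permutation]
    refine mul_ne_zero (Nat.cast_ne_zero.2 m.factorial_ne_zero) ?_
    exact_mod_cast (Equiv.Perm.sign (Fin.revPerm : Equiv.Perm (Fin m))).ne_zero
  refine ⟨c⁻¹ • ((I.restrictScalars ℂ).liftQ (ZetaAux.preTrace m S)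
    (ZetaAux.span_le_ker_preTrace hm S hS) ∘ₗ
      (Submodule.Quotient.restrictScalarsEquiv ℂ I).symm.toLinearMap), ?_⟩
  intro lam mu
  have hval : ∀ f, (c⁻¹ • ((I.restrictScalars ℂ).liftQ (ZetaAux.preTrace m S)
      (ZetaAux.span_le_ker_preTrace hm S hS) ∘ₗ
        (Submodule.Quotient.restrictScalarsEquiv ℂ I).symm.toLinearMap))
          (Ideal.Quotient.mk I f) = c⁻¹ * ZetaAux.preTrace m S f := fun f => rfl
  obtain ⟨l, hl, hlN⟩ := lam
  obtain ⟨r, hr, hrN⟩ := mu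
  have hlt : ∀ i, l i + Fin.rev i < N := fun i => by
    have := hlN i
    have := (Fin.rev i).2
    omega
  rw [hval, ZetaAux.preTrace_schurX_mul_schurXS S l r hS hlt, ← hN]
  dsimp only
  have hl' : ∀ i j : Fin m, i < j → l j + Fin.rev j < l i + Fin.rev i := fun i j hij => by
    have := hl hij.le
    have : Fin.rev j < Fin.rev i := Fin.rev_lt_rev.2 hij
    omega
  have hr' : ∀ i j : Fin m, i ≤ j → r j + Fin.rev j ≤ r i + Fin.rev i := fun i j hij => by
    have := hr hij
    have : Fin.rev j ≤ Fin.rev i := Fin.rev_le_rev.2 hij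
    omega
  constructor
  · intro h
    suffices e : (Matrix.of fun i j : Fin m => if (l i + Fin.rev i) + (r j + Fin.rev j) + 1 = N
        then (1 : ℂ) else 0) = Matrix.of fun i j : Fin m => if j = Fin.rev i then (1 : ℂ) else 0 by
      rw [e, ← hc, inv_mul_cancel₀ hc0]
    ext i j
    have hj : r j + Fin.rev j + 1 + (l (Fin.rev j) + j) = N := by
      have := h j
      have := hlN (Fin.rev j)
      have := j.2
      simp only [Fin.val_rev]
      omega
    have key : l i + Fin.rev i + (r j + Fin.rev j) + 1 = N ↔ j = Fin.rev i := by
      constructor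
      · intro e
        have e' : l i + Fin.rev i = l (Fin.rev j) + Fin.rev (Fin.rev j) := by
          rw [Fin.rev_rev]
          omega
        rcases lt_trichotomy i (Fin.rev j) with h | h | h
        · have := hl' _ _ h
          omega
        · rw [h, Fin.rev_rev]
        · have := hl' _ _ h
          omega
      · rintro rfl
        rw [Fin.rev_rev] at hj ⊢
        omega
    simp only [Matrix.of_apply, key]
  · intro h
    by_cases hex : ∀ i, ∃ j, (l i + Fin.rev i) + (r j + Fin.rev j) + 1 = N
    · exfalso
      choose f hf using hex
      have hmono : StrictMono (Fin.rev ∘ f) := by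
        intro i j hij
        refine Fin.rev_lt_rev.2 (lt_of_not_ge fun hle => ?_)
        have := hr' _ _ hle
        have := hl' _ _ hij
        have := hf i
        have := hf j
        omega
      refine h fun j => ?_
      have e : f (Fin.rev j) = j := by
        have := hmono.apply_eq (x := Fin.rev j)
        exact Fin.rev_injective this
      have h1 := hf (Fin.rev j)
      rw [e, Fin.rev_rev] at h1
      have := hlN (Fin.rev j)
      have := j.2
      simp only [Fin.val_rev] at h1
      omega
    · push Not at hex
      obtain ⟨i, hi⟩ := hex
      rw [Matrix.det_eq_zero_of_row_eq_zero i fun j => by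
        rw [Matrix.of_apply, if_neg (hi j)], mul_zero, mul_zero]
end

section
/- Let 1 ≤ m ≤ N and let Σ be a multiset of N complex numbers. Then the sequence h_N(X−Σ), h_{N−1}(X−Σ), …, h_{N+1−m}(X−Σ) is a regular sequence in the ring Sym of symmetric polynomials in ℂ[x₁,…,x_m] (i.e., h_N(X−Σ) is not a zero divisor in Sym, and each subsequent element is not a zero divisor in the quotient of Sym by the ideal generated by the preceding ones). -/
set_option synthInstance.maxHeartbeats 1000000
set_option maxHeartbeats 1000000

open MvPolynomial

section CompleteHomogeneous

variable {σ : Type*} [DecidableEq σ] (R : Type*) [CommRing R]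

/-- The complete homogeneous symmetric polynomial of degree `k` in the variables indexed by `s`. -/
noncomputable def hsymmOn (s : Finset σ) (k : ℕ) : MvPolynomial σ R :=
  ∑ c ∈ s.finsuppAntidiag k, monomial c 1

theorem hsymmOn_univ [Fintype σ] (k : ℕ) : hsymmOn R Finset.univ k = hsymm σ R k := by
  unfold hsymmOn hsymm
  symm
  refine Finset.sum_bij (fun s _ => Multiset.toFinsupp s.1) ?_ ?_ ?_ ?_
  · intro s _
    rw [Finset.mem_finsuppAntidiag']
    refine ⟨?_, Finset.subset_univ _⟩
    have h := Multiset.toFinsupp_sum_eq s.1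
    rw [s.2] at h
    exact h
  · intro s _ t _ h
    exact Subtype.ext (Multiset.toFinsupp.injective h)
  · intro c hc
    rw [Finset.mem_finsuppAntidiag'] at hc
    refine ⟨⟨Finsupp.toMultiset c, ?_⟩, Finset.mem_univ _, ?_⟩
    · rw [Finsupp.card_toMultiset]; exact hc.1
    · exact Finsupp.toMultiset_toFinsupp c
  · intro s _
    induction s.1 using Multiset.induction_on with
    | empty => simp
    | cons a t ih =>
      rw [Multiset.map_cons, Multiset.prod_cons, ih, ← Multiset.singleton_add,
        Multiset.toFinsupp_add, Multiset.toFinsupp_singleton, X, monomial_mul, one_mul]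

theorem mem_finsuppAntidiag_iff_degree {s : Finset σ} {k : ℕ} {c : σ →₀ ℕ} :
    c ∈ s.finsuppAntidiag k ↔ c.degree = k ∧ c.support ⊆ s :=
  Finset.mem_finsuppAntidiag'

theorem hsymmOn_insert {a : σ} {s : Finset σ} (ha : a ∉ s) (k : ℕ) :
    hsymmOn R (insert a s) (k + 1) = hsymmOn R s (k + 1) + X a * hsymmOn R (insert a s) k := by
  unfold hsymmOn
  rw [← Finset.sum_filter_add_sum_filter_not ((insert a s).finsuppAntidiag (k + 1))
    (fun c => c a = 0), Finset.mul_sum]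
  congr 1
  · refine Finset.sum_congr ?_ fun _ _ => rfl
    ext c
    simp only [Finset.mem_filter, mem_finsuppAntidiag_iff_degree]
    constructor
    · rintro ⟨⟨h1, h2⟩, h3⟩
      exact ⟨h1, (Finset.subset_insert_iff_of_notMem (Finsupp.notMem_support_iff.2 h3)).1 h2⟩
    · rintro ⟨h1, h2⟩
      exact ⟨⟨h1, h2.trans (Finset.subset_insert _ _)⟩,
        Finsupp.notMem_support_iff.1 fun h => ha (h2 h)⟩
  · symm
    refine Finset.sum_bij (fun c _ => Finsupp.single a 1 + c) ?_ ?_ ?_ ?_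
    · intro c hc
      rw [mem_finsuppAntidiag_iff_degree] at hc
      simp only [Finset.mem_filter, mem_finsuppAntidiag_iff_degree]
      refine ⟨⟨?_, ?_⟩, by simp⟩
      · rw [map_add, Finsupp.degree_single, hc.1, add_comm]
      · refine Finsupp.support_add.trans (Finset.union_subset ?_ hc.2)
        exact Finsupp.support_single_subset.trans (by simp)
    · intro c _ c' _ h
      exact add_left_cancel h
    · intro c hc
      simp only [Finset.mem_filter, mem_finsuppAntidiag_iff_degree] at hc
      obtain ⟨⟨h1, h2⟩, h3⟩ := hc
      have hle : Finsupp.single a 1 ≤ c := by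
        rw [Finsupp.single_le_iff]; omega
      obtain ⟨e, rfl⟩ := exists_add_of_le hle
      refine ⟨e, ?_, rfl⟩
      rw [map_add, Finsupp.degree_single] at h1
      rw [mem_finsuppAntidiag_iff_degree]
      exact ⟨by omega, (Finsupp.support_mono le_add_self).trans h2⟩
    · intro c _
      rw [X, monomial_mul, one_mul]

end CompleteHomogeneous

section Reduction

variable {m : ℕ} {R : Type*} [CommRing R]

/-- The variables of index at least `i`. -/
def finFrom (m i : ℕ) : Finset (Fin m) := Finset.univ.filter fun j => i ≤ j.val

theorem insert_finFrom {i : ℕ} (hi : i < m) :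
    insert ⟨i, hi⟩ (finFrom m (i + 1)) = finFrom m i := by
  ext j
  simp only [finFrom, Finset.mem_insert, Finset.mem_filter, Finset.mem_univ, true_and, Fin.ext_iff]
  omega

theorem totalDegree_X_mul_le {σ : Type*} (i : σ) (p : MvPolynomial σ R) :
    (X i * p).totalDegree ≤ p.totalDegree + 1 := by
  cases subsingleton_or_nontrivial R
  · simp [Subsingleton.elim (X i * p) 0]
  refine (totalDegree_mul _ _).trans ?_
  rw [totalDegree_X, add_comm]

theorem hsymmOn_finFrom_mul_mem (U : Submodule R (MvPolynomial (Fin m) R)) (M D : ℕ)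
    (hU : ∀ k, M + 1 ≤ k → k ≤ M + m → ∀ p : MvPolynomial (Fin m) R, p.totalDegree + k ≤ D →
      hsymm (Fin m) R k * p ∈ U) (i : ℕ) (hi : i ≤ m) (k : ℕ) (hik : M + 1 + i ≤ k)
    (hk : k ≤ M + m) (p : MvPolynomial (Fin m) R) (hp : p.totalDegree + k ≤ D) :
    hsymmOn R (finFrom m i) k * p ∈ U := by
  induction i generalizing k p with
  | zero =>
    have : finFrom m 0 = Finset.univ := by simp [finFrom]
    rw [this, hsymmOn_univ]
    exact hU k hik hk p hp
  | succ i ih =>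
    obtain ⟨k, rfl⟩ : ∃ l, k = l + 1 := ⟨k - 1, by omega⟩
    have hins := hsymmOn_insert R (a := ⟨i, hi⟩) (s := finFrom m (i + 1)) (by simp [finFrom]) k
    rw [insert_finFrom] at hins
    rw [← sub_eq_iff_eq_add] at hins
    rw [← hins, sub_mul, mul_assoc, mul_left_comm]
    refine U.sub_mem (ih (by omega) _ (by omega) hk p hp) (ih (by omega) _ (by omega) (by omega) _ ?_)
    have := totalDegree_X_mul_le (⟨i, hi⟩ : Fin m) p
    omega

theorem monomial_mem_of_reduced_mem (U : Submodule R (MvPolynomial (Fin m) R)) (d : Fin m → ℕ)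
    (D : ℕ)
    (hred : ∀ c : Fin m →₀ ℕ, c.degree = D → (∀ i, c i < d i) → monomial c 1 ∈ U)
    (hU : ∀ (i : Fin m) (p : MvPolynomial (Fin m) R), p.totalDegree + d i ≤ D →
      hsymmOn R (finFrom m i) (d i) * p ∈ U)
    (c : Fin m →₀ ℕ) (hc : c.degree = D) : monomial c (1 : R) ∈ U := by
  induction hx : toLex c using WellFoundedLT.induction generalizing c with
  | ind x ih =>
    subst hx
    by_cases h : ∀ i, c i < d i
    · exact hred c hc h
    push Not at h
    obtain ⟨i, hi⟩ := h
    have hle : Finsupp.single i (d i) ≤ c := by rwa [Finsupp.single_le_iff]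
    obtain ⟨b, rfl⟩ := exists_add_of_le hle
    have hb : b.degree + d i = D := by
      rw [← hc, map_add, Finsupp.degree_single, add_comm]
    have hmem := hU i (monomial b 1) (by
      have := totalDegree_monomial_le b (1 : R)
      rw [← hb]
      exact Nat.add_le_add_right this _)
    have hs : Finsupp.single i (d i) ∈ (finFrom m i).finsuppAntidiag (d i) := by
      rw [mem_finsuppAntidiag_iff_degree]
      refine ⟨by simp, Finsupp.support_single_subset.trans (by simp [finFrom])⟩
    unfold hsymmOn at hmem
    rw [← Finset.add_sum_erase _ _ hs, add_mul, monomial_mul, one_mul, Finset.sum_mul] at hmem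
    rw [← add_sub_cancel_right (monomial _ (1 : R))]
    refine U.sub_mem hmem (U.sum_mem fun a ha => ?_)
    rw [Finset.mem_erase, mem_finsuppAntidiag_iff_degree] at ha
    obtain ⟨hne, hdeg, hsupp⟩ := ha
    have hz : ∀ j < i, a j = 0 := fun j hj => by
      by_contra h0
      have := hsupp (Finsupp.mem_support_iff.2 h0)
      simp only [finFrom, Finset.mem_filter, Finset.mem_univ, true_and] at this
      exact absurd hj (not_lt.2 this)
    have hlt : a i < d i := by
      have hle : a i ≤ d i := hdeg ▸ Finsupp.le_degree i a
      refine lt_of_le_of_ne hle fun heq => hne ?_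
      have h1 : Finsupp.single i (d i) ≤ a := by rw [Finsupp.single_le_iff, heq]
      obtain ⟨e, he⟩ := exists_add_of_le h1
      have h2 : e.degree = 0 := by
        rw [he, map_add, Finsupp.degree_single] at hdeg
        omega
      rw [Finsupp.degree_eq_zero_iff] at h2
      rw [he, h2, add_zero]
    rw [monomial_mul, one_mul]
    refine ih (toLex (a + b)) ?_ _ ?_ rfl
    · rw [Finsupp.Lex.lt_iff]
      refine ⟨i, fun j hj => ?_, ?_⟩
      · simp [hz j hj, hj.ne]
      · simpa using hlt
    · rw [map_add, hdeg, ← hb, add_comm]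

end Reduction

section QuotRem

variable {m : ℕ} {K : Type*} [Field K]

/-- The linear map sending the monomial `x ^ c` to `∏ i, f i ^ (c i / d i) * x i ^ (c i % d i)`. -/
noncomputable def quotRemMap (d : Fin m → ℕ) (f : Fin m → MvPolynomial (Fin m) K) :
    MvPolynomial (Fin m) K →ₗ[K] MvPolynomial (Fin m) K :=
  (basisMonomials (Fin m) K).constr K
    fun c => ∏ i, (f i ^ (c i / d i) * X i ^ (c i % d i))

variable {d : Fin m → ℕ} {f : Fin m → MvPolynomial (Fin m) K}

theorem quotRemMap_monomial (c : Fin m →₀ ℕ) :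
    quotRemMap d f (monomial c 1) = ∏ i, (f i ^ (c i / d i) * X i ^ (c i % d i)) := by
  have h := (basisMonomials (Fin m) K).constr_basis K
    (fun c => ∏ i, (f i ^ (c i / d i) * X i ^ (c i % d i))) c
  rwa [coe_basisMonomials] at h

theorem quotRemMap_monomial_of_lt (c : Fin m →₀ ℕ) (hc : ∀ i, c i < d i) :
    quotRemMap d f (monomial c 1) = monomial c 1 := by
  rw [quotRemMap_monomial, monomial_eq, C_1, one_mul, Finsupp.prod_fintype _ _ (by simp)]
  exact Finset.prod_congr rfl fun i _ => by
    rw [Nat.div_eq_of_lt (hc i), Nat.mod_eq_of_lt (hc i), pow_zero, one_mul]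

theorem quotRemMap_X_pow_mul (hd : ∀ i, 0 < d i) (j : Fin m) (p : MvPolynomial (Fin m) K) :
    quotRemMap d f (X j ^ d j * p) = f j * quotRemMap d f p := by
  suffices h : quotRemMap d f ∘ₗ LinearMap.mulLeft K (X j ^ d j) =
      LinearMap.mulLeft K (f j) ∘ₗ quotRemMap d f from LinearMap.congr_fun h p
  refine (basisMonomials (Fin m) K).ext fun c => ?_
  simp only [LinearMap.comp_apply, LinearMap.mulLeft_apply, coe_basisMonomials]
  rw [X_pow_eq_monomial, monomial_mul, one_mul, quotRemMap_monomial, quotRemMap_monomial,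
    ← Finset.mul_prod_erase _ _ (Finset.mem_univ j),
    ← Finset.mul_prod_erase Finset.univ (fun i => f i ^ (c i / d i) * X i ^ (c i % d i))
      (Finset.mem_univ j), ← mul_assoc]
  congr 1
  · simp [Nat.add_div_left _ (hd j), pow_succ', mul_assoc]
  · refine Finset.prod_congr rfl fun i hi => ?_
    simp [(Finset.ne_of_mem_erase hi).symm]

theorem quotRemMap_mem_restrictTotalDegree (hf : ∀ i, (f i).totalDegree ≤ d i) (D : ℕ) :
    ∀ p ∈ restrictTotalDegree (Fin m) K D,
      quotRemMap d f p ∈ restrictTotalDegree (Fin m) K D := by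
  intro p hp
  rw [mem_restrictTotalDegree] at hp
  rw [p.as_sum, map_sum]
  refine Submodule.sum_mem _ fun c hc => ?_
  rw [← mul_one (coeff c p), ← smul_eq_mul, ← smul_monomial, map_smul]
  refine Submodule.smul_mem _ _ ?_
  rw [quotRemMap_monomial, mem_restrictTotalDegree]
  have hcD : c.degree ≤ D := (le_totalDegree hc).trans hp
  refine (totalDegree_finsetProd _ _).trans (le_trans ?_ hcD)
  rw [Finsupp.degree_eq_sum]
  refine Finset.sum_le_sum fun i _ => ?_
  refine (totalDegree_mul _ _).trans ?_
  refine (Nat.add_le_add ((totalDegree_pow _ _).trans (Nat.mul_le_mul_left _ (hf i)))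
    (totalDegree_pow _ _)).trans ?_
  rw [totalDegree_X, mul_one]
  exact (Nat.div_add_mod' _ _).le

/-- If `f i` has degree `d i = M + 1 + i` and leading form the complete homogeneous symmetric
polynomial, then `quotRemMap d f` maps the polynomials of degree at most `D` onto themselves. -/
theorem restrictTotalDegree_le_map_quotRemMap (M : ℕ) (hd : ∀ i, d i = M + 1 + i)
    (hf : ∀ i, (f i - hsymm (Fin m) K (d i)).totalDegree < d i) (D : ℕ) :
    restrictTotalDegree (Fin m) K D ≤ (restrictTotalDegree (Fin m) K D).map (quotRemMap d f) := by
  have hpos : ∀ i, 0 < d i := fun i => by rw [hd]; omega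
  induction D using Nat.strong_induction_on with
  | _ D ih =>
  set U := (restrictTotalDegree (Fin m) K D).map (quotRemMap d f)
  have hlow : ∀ p : MvPolynomial (Fin m) K, p.totalDegree < D → p ∈ U := fun p hp => by
    refine Submodule.map_mono ?_ (ih _ hp ((mem_restrictTotalDegree _ _ _).2 le_rfl))
    intro q hq
    rw [mem_restrictTotalDegree] at hq ⊢
    omega
  have hh : ∀ k, M + 1 ≤ k → k ≤ M + m → ∀ p : MvPolynomial (Fin m) K, p.totalDegree + k ≤ D →
      hsymm (Fin m) K k * p ∈ U := by
    intro k h1 h2 p hp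
    obtain ⟨i, rfl⟩ : ∃ i : Fin m, d i = k :=
      ⟨⟨k - (M + 1), by omega⟩, by rw [hd]; dsimp only; omega⟩
    have hi := hpos i
    obtain ⟨q, hq, hqp⟩ := ih p.totalDegree (by omega) ((mem_restrictTotalDegree _ _ _).2 le_rfl)
    rw [← sub_sub_cancel (f i) (hsymm (Fin m) K (d i)), sub_mul]
    refine U.sub_mem ⟨X i ^ d i * q, ?_, ?_⟩ (hlow _ ?_)
    · rw [SetLike.mem_coe, mem_restrictTotalDegree] at hq ⊢
      refine (totalDegree_mul _ _).trans ?_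
      rw [totalDegree_X_pow]
      omega
    · rw [quotRemMap_X_pow_mul hpos, hqp]
    · have := hf i
      have := totalDegree_mul (f i - hsymm (Fin m) K (d i)) p
      omega
  have hmon : ∀ c : Fin m →₀ ℕ, c.degree = D → monomial c (1 : K) ∈ U := by
    refine monomial_mem_of_reduced_mem U d D (fun c hc hlt => ?_) fun i p hp => ?_
    · refine ⟨monomial c 1, ?_, quotRemMap_monomial_of_lt c hlt⟩
      rw [SetLike.mem_coe, mem_restrictTotalDegree, ← hc]
      exact totalDegree_monomial_le _ _
    · exact hsymmOn_finFrom_mul_mem U M D hh i i.2.le _ (hd i).ge (by rw [hd]; omega) p hp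
  intro p hp
  rw [mem_restrictTotalDegree] at hp
  rw [p.as_sum]
  refine Submodule.sum_mem _ fun c hc => ?_
  rw [← mul_one (coeff c p), ← smul_eq_mul, ← smul_monomial]
  refine Submodule.smul_mem _ _ ?_
  have hcD : c.degree ≤ D := (le_totalDegree hc).trans hp
  rcases hcD.lt_or_eq with h | h
  · exact hlow _ ((totalDegree_monomial_le _ _).trans_lt h)
  · exact hmon c h

theorem quotRemMap_bijective (hf : ∀ i, (f i).totalDegree ≤ d i)
    (hle : ∀ D, restrictTotalDegree (Fin m) K D ≤
      (restrictTotalDegree (Fin m) K D).map (quotRemMap d f)) :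
    Function.Bijective (quotRemMap d f) := by
  constructor
  · rw [injective_iff_map_eq_zero]
    intro p hp
    let V := restrictTotalDegree (Fin m) K p.totalDegree
    let g : V →ₗ[K] V := (quotRemMap d f).restrict (quotRemMap_mem_restrictTotalDegree hf _)
    have hg : Function.Surjective g := by
      rintro ⟨q, hq⟩
      obtain ⟨r, hr, hrq⟩ := hle _ hq
      exact ⟨⟨r, hr⟩, Subtype.ext hrq⟩
    have hinj := LinearMap.injective_iff_surjective.2 hg
    have hpV : p ∈ V := (mem_restrictTotalDegree _ _ _).2 le_rfl
    have := @hinj ⟨p, hpV⟩ 0 (by rw [map_zero]; exact Subtype.ext hp)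
    exact congrArg Subtype.val this
  · intro q
    obtain ⟨r, -, hr⟩ := hle _ ((mem_restrictTotalDegree _ q.totalDegree q).2 le_rfl)
    exact ⟨r, hr⟩

theorem quotRemMap_mem_span_iff (hd : ∀ i, 0 < d i) (hb : Function.Bijective (quotRemMap d f))
    (J : Set (Fin m)) (p : MvPolynomial (Fin m) K) :
    quotRemMap d f p ∈ Ideal.span (f '' J) ↔
      p ∈ Ideal.span ((fun i => (X i ^ d i : MvPolynomial (Fin m) K)) '' J) := by
  constructor
  · intro h
    suffices H : ∀ x ∈ Ideal.span (f '' J), ∃ q ∈ Ideal.span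
        ((fun i => (X i ^ d i : MvPolynomial (Fin m) K)) '' J), quotRemMap d f q = x by
      obtain ⟨q, hq, hqp⟩ := H _ h
      rwa [← hb.1 hqp]
    intro x hx
    obtain ⟨r, rfl⟩ := hb.2 x
    refine Submodule.span_induction (p := fun x _ => ∀ a, ∃ q ∈ Ideal.span
        ((fun i => (X i ^ d i : MvPolynomial (Fin m) K)) '' J), quotRemMap d f q = a * x)
      ?_ ?_ ?_ ?_ hx 1 |>.imp fun q hq => by simpa using hq
    · rintro _ ⟨i, hi, rfl⟩ a
      obtain ⟨b, rfl⟩ := hb.2 a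
      exact ⟨X i ^ d i * b, Ideal.mul_mem_right _ _ (Ideal.subset_span ⟨i, hi, rfl⟩),
        by rw [quotRemMap_X_pow_mul hd, mul_comm]⟩
    · exact fun a => ⟨0, zero_mem _, by simp⟩
    · intro x y _ _ hx hy a
      obtain ⟨q, hq, hqx⟩ := hx a
      obtain ⟨r, hr, hry⟩ := hy a
      exact ⟨q + r, add_mem hq hr, by rw [map_add, hqx, hry, mul_add]⟩
    · intro b x _ hx a
      obtain ⟨q, hq, hqx⟩ := hx (a * b)
      exact ⟨q, hq, by rw [hqx, smul_eq_mul, mul_assoc]⟩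
  · intro h
    refine Submodule.span_induction (p := fun x _ => ∀ a, quotRemMap d f (a * x) ∈
      Ideal.span (f '' J)) ?_ ?_ ?_ ?_ h 1 |> fun h => by simpa using h
    · rintro _ ⟨i, hi, rfl⟩ a
      rw [mul_comm, quotRemMap_X_pow_mul hd]
      exact Ideal.mul_mem_right _ _ (Ideal.subset_span ⟨i, hi, rfl⟩)
    · simp
    · intro x y _ _ hx hy a
      rw [mul_add, map_add]
      exact add_mem (hx a) (hy a)
    · intro b x _ hx a
      rw [smul_eq_mul, ← mul_assoc]
      exact hx (a * b)

theorem mem_span_X_pow_of_X_pow_mul_mem {J : Set (Fin m)} {k : Fin m} (hk : k ∉ J)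
    {p : MvPolynomial (Fin m) K}
    (h : X k ^ d k * p ∈ Ideal.span ((fun i => (X i ^ d i : MvPolynomial (Fin m) K)) '' J)) :
    p ∈ Ideal.span ((fun i => (X i ^ d i : MvPolynomial (Fin m) K)) '' J) := by
  have himg : (fun i => (X i ^ d i : MvPolynomial (Fin m) K)) '' J =
      (fun c => monomial c (1 : K)) '' ((fun i => Finsupp.single i (d i)) '' J) := by
    rw [Set.image_image]
    simp only [X_pow_eq_monomial]
  rw [himg, mem_ideal_span_monomial_image] at h ⊢
  intro c hc
  obtain ⟨_, ⟨i, hi, rfl⟩, hle⟩ := h (Finsupp.single k (d k) + c) (by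
    rw [X_pow_eq_monomial, mem_support_iff, coeff_monomial_mul, one_mul]
    exact mem_support_iff.1 hc)
  refine ⟨_, ⟨i, hi, rfl⟩, ?_⟩
  have hne : k ≠ i := fun h => hk (h ▸ hi)
  rw [Finsupp.single_le_iff] at hle ⊢
  simpa [Finsupp.single_apply, hne] using hle

/-- A family of polynomials in `m` variables whose leading forms are complete homogeneous symmetric
polynomials of consecutive positive degrees is regular in any order. -/
theorem mem_span_of_mul_mem_span (M : ℕ) (hd : ∀ i, d i = M + 1 + i)
    (hf : ∀ i, (f i - hsymm (Fin m) K (d i)).totalDegree < d i)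
    (hf' : ∀ i, (f i).totalDegree ≤ d i) {J : Set (Fin m)} {k : Fin m} (hk : k ∉ J)
    {g : MvPolynomial (Fin m) K} (hg : f k * g ∈ Ideal.span (f '' J)) :
    g ∈ Ideal.span (f '' J) := by
  have hpos : ∀ i, 0 < d i := fun i => by rw [hd]; omega
  have hb := quotRemMap_bijective hf' (restrictTotalDegree_le_map_quotRemMap M hd hf)
  obtain ⟨p, rfl⟩ := hb.2 g
  rw [← quotRemMap_X_pow_mul hpos, quotRemMap_mem_span_iff hpos hb] at hg
  exact (quotRemMap_mem_span_iff hpos hb J p).2 (mem_span_X_pow_of_X_pow_mul_mem hk hg)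

end QuotRem

section Reynolds

variable {σ : Type*} [Fintype σ] [DecidableEq σ] {K : Type*} [Field K]

/-- The average of a polynomial over all permutations of the variables. -/
noncomputable def reynolds (p : MvPolynomial σ K) : symmetricSubalgebra σ K :=
  ⟨C ((Fintype.card (Equiv.Perm σ) : K)⁻¹) * ∑ e : Equiv.Perm σ, rename e p, by
    rw [mem_symmetricSubalgebra]
    intro e
    rw [map_mul, rename_C, map_sum]
    congr 1
    refine Fintype.sum_equiv (Equiv.mulLeft e) _ _ fun e' => ?_
    rw [rename_rename]
    rfl⟩

theorem reynolds_add (p q : MvPolynomial σ K) : reynolds (p + q) = reynolds p + reynolds q :=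
  Subtype.ext (by simp [reynolds, Finset.sum_add_distrib, mul_add])

theorem reynolds_mul_coe (p : MvPolynomial σ K) (s : symmetricSubalgebra σ K) :
    reynolds (p * (s : MvPolynomial σ K)) = reynolds p * s := by
  refine Subtype.ext ?_
  have hs := (mem_symmetricSubalgebra _).1 s.2
  simp only [reynolds, map_mul, MulMemClass.coe_mul]
  rw [Finset.sum_congr rfl fun e _ => by rw [hs e], ← Finset.sum_mul, mul_assoc]

theorem reynolds_coe [CharZero K] (s : symmetricSubalgebra σ K) : reynolds (s : MvPolynomial σ K) = s := by
  refine Subtype.ext ?_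
  have hs := (mem_symmetricSubalgebra _).1 s.2
  simp only [reynolds]
  rw [Finset.sum_congr rfl fun e _ => hs e, Finset.sum_const, Finset.card_univ,
    nsmul_eq_mul, ← mul_assoc, ← map_natCast (C : K →+* MvPolynomial σ K), ← C_mul,
    inv_mul_cancel₀ (Nat.cast_ne_zero.2 Fintype.card_ne_zero), C_1, one_mul]

theorem mem_span_of_coe_mem_span [CharZero K] {T : Set (symmetricSubalgebra σ K)}
    {g : symmetricSubalgebra σ K}
    (hg : (g : MvPolynomial σ K) ∈ Ideal.span ((fun s : symmetricSubalgebra σ K => s.1) '' T)) :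
    g ∈ Ideal.span T := by
  rw [← reynolds_coe g]
  refine Submodule.span_induction (p := fun x _ => ∀ a, reynolds (a * x) ∈ Ideal.span T)
    ?_ ?_ ?_ ?_ hg 1 |> fun h => by simpa using h
  · rintro _ ⟨s, hs, rfl⟩ a
    rw [reynolds_mul_coe]
    exact Ideal.mul_mem_left _ _ (Ideal.subset_span hs)
  · intro a
    have h := reynolds_mul_coe a (0 : symmetricSubalgebra σ K)
    rw [mul_zero, ZeroMemClass.coe_zero] at h
    rw [h]
    exact zero_mem _
  · intro x y _ _ hx hy a
    rw [mul_add, reynolds_add]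
    exact add_mem (hx a) (hy a)
  · intro b x _ hx a
    rw [smul_eq_mul, ← mul_assoc]
    exact hx (a * b)

end Reynolds

theorem totalDegree_hsymm_le (m k : ℕ) : (hsymm (Fin m) ℂ k).totalDegree ≤ k := by
  rw [← hsymmOn_univ]
  refine totalDegree_finsetSum_le fun c hc => ?_
  rw [mem_finsuppAntidiag_iff_degree] at hc
  exact (totalDegree_monomial_le _ _).trans hc.1.le

theorem totalDegree_hXSElt_sub_lt (m k : ℕ) (hk : 0 < k) (S : Multiset ℂ) :
    ((hXSElt m S k : MvPolynomial (Fin m) ℂ) - hsymm (Fin m) ℂ k).totalDegree < k := by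
  have h : (hXSElt m S k : MvPolynomial (Fin m) ℂ) - hsymm (Fin m) ℂ k =
      ∑ j ∈ Finset.range k, ((-1 : ℂ) ^ (j + 1) * S.esymm (j + 1)) •
        hsymm (Fin m) ℂ (k - (j + 1)) := by
    rw [hXSElt, Finset.sum_range_succ', AddMemClass.coe_add]
    simp [hSymElt, Multiset.esymm]
  rw [h]
  refine lt_of_le_of_lt (b := k - 1) (totalDegree_finsetSum_le fun j _ => ?_) (by omega)
  refine (totalDegree_smul_le _ _).trans ((totalDegree_hsymm_le _ _).trans ?_)
  omega

theorem totalDegree_hXSElt_le (m k : ℕ) (hk : 0 < k) (S : Multiset ℂ) :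
    (hXSElt m S k : MvPolynomial (Fin m) ℂ).totalDegree ≤ k := by
  rw [← sub_add_cancel (hXSElt m S k : MvPolynomial (Fin m) ℂ) (hsymm (Fin m) ℂ k)]
  exact (totalDegree_add _ _).trans
    (max_le (totalDegree_hXSElt_sub_lt m k hk S).le (totalDegree_hsymm_le m k))

/-- The sequence `h_N(X−Σ), h_{N−1}(X−Σ), …, h_{N+1−m}(X−Σ)` is a regular sequence in the ring
of symmetric polynomials in `ℂ[x₁,…,x_m]`: for each `k < m`, the element `h_{N−k}(X−Σ)` is not a
zero divisor modulo the ideal generated by the preceding elements `h_{N−j}(X−Σ)`, `j < k`. -/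
theorem hXS_regular_sequence (N m : ℕ) (hm : 1 ≤ m) (hmN : m ≤ N)
    (S : Multiset ℂ) (hS : Multiset.card S = N) :
    ∀ k, k < m → ∀ g : symmetricSubalgebra (Fin m) ℂ,
      hXSElt m S (N - k) * g ∈
          Ideal.span ((fun j : ℕ => hXSElt m S (N - j)) '' Set.Iio k) →
        g ∈ Ideal.span ((fun j : ℕ => hXSElt m S (N - j)) '' Set.Iio k) := by
  intro k hk g hg
  apply mem_span_of_coe_mem_span
  let d : Fin m → ℕ := fun i => N - m + 1 + i
  let f : Fin m → MvPolynomial (Fin m) ℂ := fun i => hXSElt m S (d i)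
  let J : Set (Fin m) := {i | m - 1 - i < k}
  have hpos : ∀ i, 0 < d i := fun i => by simp only [d]; omega
  have himg : (fun s : symmetricSubalgebra (Fin m) ℂ => s.1) ''
      ((fun j : ℕ => hXSElt m S (N - j)) '' Set.Iio k) = f '' J := by
    ext x
    simp only [Set.mem_image, Set.mem_Iio, exists_exists_and_eq_and]
    constructor
    · rintro ⟨j, hj, rfl⟩
      refine ⟨⟨m - 1 - j, by omega⟩, ?_, ?_⟩
      · simp only [J, Set.mem_ofPred_eq]; omega
      · simp only [f, d]
        rw [show N - m + 1 + (m - 1 - j) = N - j by omega]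
    · rintro ⟨i, hi, rfl⟩
      refine ⟨m - 1 - i, hi, ?_⟩
      simp only [f, d]
      rw [show N - (m - 1 - i) = N - m + 1 + (i : ℕ) by omega]
  have hg' := Ideal.mem_map_of_mem (symmetricSubalgebra (Fin m) ℂ).val hg
  rw [Ideal.map_span, map_mul] at hg'
  change _ ∈ Ideal.span ((fun s : symmetricSubalgebra (Fin m) ℂ => s.1) '' _) at hg'
  rw [himg] at hg' ⊢
  refine mem_span_of_mul_mem_span (d := d) (k := ⟨m - 1 - k, by omega⟩) (N - m) (fun _ => rfl)
    (fun i => totalDegree_hXSElt_sub_lt m _ (hpos i) S)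
    (fun i => totalDegree_hXSElt_le m _ (hpos i) S) ?_ ?_
  · simp only [J, Set.mem_ofPred_eq]; omega
  · simp only [d]
    rw [show N - m + 1 + (m - 1 - k) = N - k by omega]
    exact hg'
end

section
/- Let Σ be a finite set of N complex numbers, let 1 ≤ m ≤ N, and let Ω ⊆ Σ with |Ω| = m. Then for every integer k > N − m, the complex number h_k(Ω−Σ) = 0. -/
open MvPolynomial

/-- The `k`-th complete homogeneous symmetric function of the elements of a finite multiset `A`
of complex numbers. -/
noncomputable def hMul (A : Multiset ℂ) (k : ℕ) : ℂ :=
  MvPolynomial.eval (fun i : Fin (Multiset.card A) => A.toList.getD i 0)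
    (hsymm (Fin (Multiset.card A)) ℂ k)

/-- `h_k(A−B) := ∑_{j=0}^{k} (−1)^j e_j(B)·h_{k−j}(A)` for finite multisets `A`, `B` of complex
numbers. -/
noncomputable def hMulSub (A B : Multiset ℂ) (k : ℕ) : ℂ :=
  ∑ j ∈ Finset.range (k + 1), (-1 : ℂ) ^ j * B.esymm j * hMul A (k - j)

/-- The generating function of the complete homogeneous symmetric functions of `f` is the product
of the geometric series with ratios `f i`. -/
theorem eval_hsymm_eq_coeff_prod {σ R : Type*} [Fintype σ] [DecidableEq σ] [CommSemiring R]
    (f : σ → R) (n : ℕ) :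
    MvPolynomial.eval f (hsymm σ R n) =
      PowerSeries.coeff n (∏ i, PowerSeries.mk fun j => f i ^ j) := by
  rw [PowerSeries.coeff_prod, hsymm, map_sum]
  refine Finset.sum_bij (fun s _ => Multiset.toFinsupp s.1) ?_ ?_ ?_ ?_
  · rintro ⟨s, hs⟩ -
    rw [Finset.mem_finsuppAntidiag']
    exact ⟨(Multiset.toFinsupp_sum_eq s).trans hs, Finset.subset_univ _⟩
  · intro s _ t _ h
    exact Subtype.ext (Multiset.toFinsupp.injective h)
  · intro l hl
    refine ⟨⟨Finsupp.toMultiset l, ?_⟩, Finset.mem_univ _, by simp⟩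
    rw [Finset.mem_finsuppAntidiag'] at hl
    rw [Finsupp.card_toMultiset]
    exact hl.1
  · rintro ⟨s, hs⟩ -
    simp only [PowerSeries.coeff_mk, Multiset.toFinsupp_apply, map_multiset_prod, Multiset.map_map,
      Function.comp_def, eval_X]
    exact Finset.prod_multiset_map_count s f |>.trans
      (Finset.prod_subset (Finset.subset_univ _) fun i _ hi => by
        simp [Multiset.count_eq_zero.mpr (by simpa using hi)])

/-- The generating function of the signed elementary symmetric functions of a multiset. -/
theorem coeff_prod_one_sub_C_mul_X {R : Type*} [CommRing R] (s : Multiset R) (n : ℕ) :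
    PowerSeries.coeff n (s.map fun a => 1 - PowerSeries.C a * PowerSeries.X).prod =
      (-1) ^ n * s.esymm n := by
  induction s using Multiset.induction_on generalizing n with
  | empty =>
    cases n with
    | zero => simp [Multiset.esymm]
    | succ n =>
      rw [Multiset.esymm, Multiset.powersetCard_eq_empty _ (by simp)]
      simp [PowerSeries.coeff_one]
  | cons a s ih =>
    rw [Multiset.map_cons, Multiset.prod_cons, sub_mul, one_mul, map_sub, ih, mul_assoc,
      PowerSeries.coeff_C_mul]
    cases n with
    | zero => simp [Multiset.esymm]
    | succ n =>
      rw [PowerSeries.coeff_succ_X_mul, ih]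
      simp only [Multiset.esymm, Multiset.powersetCard_cons, Multiset.map_add, Multiset.sum_add,
        Multiset.map_map, Function.comp_def, Multiset.prod_cons, Multiset.sum_map_mul_left]
      ring

theorem mk_pow_mul_one_sub_C_mul_X {R : Type*} [CommRing R] (a : R) :
    (PowerSeries.mk fun j => a ^ j) * (1 - PowerSeries.C a * PowerSeries.X) = 1 := by
  ext n
  rw [mul_sub, mul_one, mul_left_comm, map_sub, PowerSeries.coeff_C_mul]
  cases n with
  | zero => simp
  | succ n => simp [PowerSeries.coeff_succ_mul_X, PowerSeries.coeff_one, pow_succ']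

theorem List.prod_getD_eq_prod_map {α M : Type*} [CommMonoid M] (l : List α) (d : α) (g : α → M)
    {n : ℕ} (h : l.length = n) : ∏ i : Fin n, g (l.getD i d) = (l.map g).prod := by
  subst h
  simp [Fin.prod_univ_fun_getElem]

theorem hMul_eq_coeff_prod (A : Multiset ℂ) (k : ℕ) :
    hMul A k = PowerSeries.coeff k (A.map fun a => PowerSeries.mk fun j => a ^ j).prod := by
  rw [hMul, eval_hsymm_eq_coeff_prod,
    List.prod_getD_eq_prod_map A.toList 0 (fun a => PowerSeries.mk fun j => a ^ j) (by simp),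
    ← Multiset.prod_coe, ← Multiset.map_coe, Multiset.coe_toList]

theorem hMulSub_eq_coeff_mul (A B : Multiset ℂ) (k : ℕ) :
    hMulSub A B k = PowerSeries.coeff k
      ((B.map fun a => 1 - PowerSeries.C a * PowerSeries.X).prod *
        (A.map fun a => PowerSeries.mk fun j => a ^ j).prod) := by
  rw [PowerSeries.coeff_mul, Finset.Nat.sum_antidiagonal_eq_sum_range_succ_mk, hMulSub]
  simp only [coeff_prod_one_sub_C_mul_X, hMul_eq_coeff_prod]

/-- Cancelling the common elements: `h_k(A−(A+B)) = (−1)^k e_k(B)`. -/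
theorem hMulSub_self_add (A B : Multiset ℂ) (k : ℕ) :
    hMulSub A (A + B) k = (-1) ^ k * B.esymm k := by
  rw [hMulSub_eq_coeff_mul, ← coeff_prod_one_sub_C_mul_X, Multiset.map_add, Multiset.prod_add,
    mul_right_comm, ← Multiset.prod_map_mul]
  simp [mul_comm _ (PowerSeries.mk _), mk_pow_mul_one_sub_C_mul_X]

/-- If `Σ` is a set of `N` distinct complex numbers, `1 ≤ m ≤ N` and `Ω ⊆ Σ` with `|Ω| = m`,
then `h_k(Ω−Σ) = 0` for every `k > N − m`. -/
theorem hMulSub_eq_zero (N m : ℕ) (hm : 1 ≤ m) (hmN : m ≤ N)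
    (S : Finset ℂ) (hS : S.card = N) (Ω : Finset ℂ) (hΩS : Ω ⊆ S) (hΩ : Ω.card = m) :
    ∀ k : ℕ, N - m < k → hMulSub Ω.val S.val k = 0 := by
  intro k hk
  obtain ⟨B, hB⟩ := Multiset.le_iff_exists_add.mp (Finset.val_le_iff.mpr hΩS)
  have hcard : N = m + Multiset.card B := by
    rw [← hS, ← hΩ, Finset.card_def, Finset.card_def, hB, Multiset.card_add]
  rw [hB, hMulSub_self_add, Multiset.esymm, Multiset.powersetCard_eq_empty k (by omega)]
  simp
end

section
/- Let Σ be a set of N distinct complex numbers, let 1 ≤ m ≤ N, and let a₁,…,a_m be elements of Σ (repetitions allowed), with A the multiset {a₁,…,a_m}. Then a₁,…,a_m are pairwise distinct if and only if h_k(A−Σ) = 0 for every integer k with N + 1 − m ≤ k ≤ N. -/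
open MvPolynomial

/-- The reciprocal polynomial `∏ (1 - b X)` of the monic polynomial with root multiset `B`. -/
noncomputable def reciprocalPoly (B : Multiset ℂ) : Polynomial ℂ :=
  (B.map fun b => 1 - Polynomial.C b * Polynomial.X).prod

theorem reciprocalPoly_add (A B : Multiset ℂ) :
    reciprocalPoly (A + B) = reciprocalPoly A * reciprocalPoly B := by
  simp [reciprocalPoly]

theorem natDegree_one_sub_C_mul_X_le (b : ℂ) :
    (1 - Polynomial.C b * Polynomial.X : Polynomial ℂ).natDegree ≤ 1 := by
  compute_degree

theorem natDegree_reciprocalPoly_le (B : Multiset ℂ) :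
    (reciprocalPoly B).natDegree ≤ Multiset.card B := by
  induction B using Multiset.induction_on with
  | empty => simp [reciprocalPoly]
  | cons b B ih =>
    rw [← Multiset.singleton_add, reciprocalPoly_add, Multiset.card_add]
    refine Polynomial.natDegree_mul_le.trans (add_le_add ?_ ih)
    simpa [reciprocalPoly] using natDegree_one_sub_C_mul_X_le b

theorem reflect_reciprocalPoly (B : Multiset ℂ) :
    (reciprocalPoly B).reflect (Multiset.card B) =
      (B.map fun b => Polynomial.X - Polynomial.C b).prod := by
  induction B using Multiset.induction_on with
  | empty => simp [reciprocalPoly]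
  | cons b B ih =>
    have hb : (reciprocalPoly {b}).reflect 1 = Polynomial.X - Polynomial.C b := by
      simp [reciprocalPoly]
    rw [← Multiset.singleton_add, reciprocalPoly_add, Multiset.card_add,
      Polynomial.reflect_mul _ _ (natDegree_reciprocalPoly_le _) (natDegree_reciprocalPoly_le _),
      ih, Multiset.card_singleton, hb]
    simp

theorem coeff_reciprocalPoly (B : Multiset ℂ) (j : ℕ) :
    (reciprocalPoly B).coeff j = (-1) ^ j * B.esymm j := by
  rcases le_or_gt j (Multiset.card B) with hj | hj
  · have h := Polynomial.coeff_reflect (Multiset.card B) (reciprocalPoly B) (Multiset.card B - j)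
    rw [Polynomial.revAt_le (Nat.sub_le _ _), Nat.sub_sub_self hj, reflect_reciprocalPoly,
      Multiset.prod_X_sub_C_coeff _ (Nat.sub_le _ _), Nat.sub_sub_self hj] at h
    exact h.symm
  · rw [Polynomial.coeff_eq_zero_of_natDegree_lt ((natDegree_reciprocalPoly_le B).trans_lt hj),
      Multiset.esymm, Multiset.powersetCard_eq_empty _ hj]
    simp

theorem mk_eval_hsymm {n : ℕ} (f : Fin n → ℂ) :
    PowerSeries.mk (fun k => MvPolynomial.eval f (hsymm (Fin n) ℂ k)) =
      ∏ i, PowerSeries.mk (fun k => f i ^ k) := by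
  ext k
  rw [PowerSeries.coeff_mk, PowerSeries.coeff_prod, hsymm, map_sum]
  simp only [PowerSeries.coeff_mk]
  refine Finset.sum_bij' (fun s _ => Multiset.toFinsupp s.1)
    (fun l hl => ⟨Finsupp.toMultiset l, ?_⟩) ?_ ?_ ?_ ?_ ?_
  · rw [Finsupp.card_toMultiset, Finsupp.sum_fintype _ _ (fun _ => rfl)]
    exact (Finset.mem_finsuppAntidiag.mp hl).1
  · intro s _
    refine Finset.mem_finsuppAntidiag.mpr ⟨?_, Finset.subset_univ _⟩
    exact (Multiset.sum_count_eq_card fun i _ => Finset.mem_univ i).trans s.2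
  · exact fun _ _ => Finset.mem_univ _
  · intro s _
    ext1
    simp
  · intro l _
    simp
  · intro s _
    rw [map_multiset_prod, Multiset.map_map, Finset.prod_multiset_map_count,
      Finset.prod_subset (Finset.subset_univ _)]
    · simp
    · intro i _ hi
      simp_all

theorem mk_pow_mul_one_sub (a : ℂ) :
    PowerSeries.mk (fun k => a ^ k) *
      ((1 - Polynomial.C a * Polynomial.X : Polynomial ℂ) : PowerSeries ℂ) = 1 := by
  have h := congrArg (PowerSeries.rescale a) (PowerSeries.mk_one_mul_one_sub_eq_one ℂ)
  simpa [PowerSeries.rescale_mk, PowerSeries.rescale_X] using h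

theorem mk_hMul_mul_reciprocalPoly (A : Multiset ℂ) :
    PowerSeries.mk (hMul A) * (reciprocalPoly A : PowerSeries ℂ) = 1 := by
  have hA : A = Multiset.map (fun i : Fin (Multiset.card A) => A.toList.getD i 0)
      Finset.univ.val := by
    conv_lhs => rw [← A.coe_toList]
    rw [Fin.univ_val_map, Multiset.coe_eq_coe]
    refine List.Perm.of_eq (List.ext_getElem (by simp) fun i h₁ h₂ => ?_)
    rw [List.getElem_ofFn, List.getD_eq_getElem _ _ h₁]
  have hr : reciprocalPoly A = ∏ i : Fin (Multiset.card A),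
      (1 - Polynomial.C (A.toList.getD i 0) * Polynomial.X) := by
    conv_lhs => rw [hA]
    rw [reciprocalPoly, Multiset.map_map]
    rfl
  have hh : PowerSeries.mk (hMul A) = ∏ i : Fin (Multiset.card A),
      PowerSeries.mk (fun k => A.toList.getD i 0 ^ k) :=
    mk_eval_hsymm (fun i : Fin (Multiset.card A) => A.toList.getD i 0)
  rw [hh, hr, ← Polynomial.coeToPowerSeries.ringHom_apply, map_prod, ← Finset.prod_mul_distrib]
  exact Finset.prod_eq_one fun i _ => mk_pow_mul_one_sub _

theorem mk_hMulSub (A B : Multiset ℂ) :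
    PowerSeries.mk (hMulSub A B) =
      (reciprocalPoly B : PowerSeries ℂ) * PowerSeries.mk (hMul A) := by
  ext k
  rw [PowerSeries.coeff_mk, PowerSeries.coeff_mul, Finset.Nat.sum_antidiagonal_eq_sum_range_succ_mk,
    hMulSub]
  simp [coeff_reciprocalPoly]

theorem mk_hMulSub_mul_reciprocalPoly (A B : Multiset ℂ) :
    PowerSeries.mk (hMulSub A B) * (reciprocalPoly A : PowerSeries ℂ) = reciprocalPoly B := by
  rw [mk_hMulSub, mul_assoc, mk_hMul_mul_reciprocalPoly, mul_one]

theorem mk_hMulSub_add_right (A R : Multiset ℂ) :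
    PowerSeries.mk (hMulSub A (A + R)) = reciprocalPoly R := by
  rw [mk_hMulSub, reciprocalPoly_add, Polynomial.coe_mul, mul_right_comm,
    mul_comm (reciprocalPoly A : PowerSeries ℂ), mk_hMul_mul_reciprocalPoly, one_mul]

theorem hMulSub_eq_zero_of_le {A B : Multiset ℂ} (h : A ≤ B) {k : ℕ}
    (hk : Multiset.card B < k + Multiset.card A) : hMulSub A B k = 0 := by
  obtain ⟨R, rfl⟩ := Multiset.le_iff_exists_add.mp h
  rw [← PowerSeries.coeff_mk k (hMulSub A (A + R)), mk_hMulSub_add_right, Polynomial.coeff_coe]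
  refine Polynomial.coeff_eq_zero_of_natDegree_lt ((natDegree_reciprocalPoly_le R).trans_lt ?_)
  rw [Multiset.card_add] at hk
  omega

theorem le_of_hMulSub_eq_zero {A B : Multiset ℂ} (hAB : Multiset.card A ≤ Multiset.card B)
    (h : ∀ k, Multiset.card B + 1 - Multiset.card A ≤ k → k ≤ Multiset.card B →
      hMulSub A B k = 0) : A ≤ B := by
  set d := Multiset.card B - Multiset.card A with hd
  have hdB : d + Multiset.card A = Multiset.card B := by omega
  set f := (PowerSeries.mk (hMulSub A B)).trunc (d + 1) with hf
  have hfd : f.natDegree ≤ d := Nat.lt_succ_iff.mp (PowerSeries.natDegree_trunc_lt _ d)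
  have hmul : reciprocalPoly B = f * reciprocalPoly A := by
    ext k
    rcases le_or_gt k (Multiset.card B) with hk | hk
    · rw [← Polynomial.coeff_coe, ← mk_hMulSub_mul_reciprocalPoly A B, PowerSeries.coeff_mul,
        Polynomial.coeff_mul]
      refine Finset.sum_congr rfl fun p hp => ?_
      have := Finset.HasAntidiagonal.mem_antidiagonal.mp hp
      rw [Polynomial.coeff_coe, hf, PowerSeries.coeff_trunc, PowerSeries.coeff_mk]
      split_ifs with hlt
      · rfl
      · rw [h p.1 (by omega) (by omega)]
    · rw [Polynomial.coeff_eq_zero_of_natDegree_lt ((natDegree_reciprocalPoly_le B).trans_lt hk),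
        Polynomial.coeff_eq_zero_of_natDegree_lt]
      refine lt_of_le_of_lt (Polynomial.natDegree_mul_le.trans
        (add_le_add hfd (natDegree_reciprocalPoly_le A))) (hdB ▸ hk)
  have hdvd : (A.map fun a => Polynomial.X - Polynomial.C a).prod ∣
      (B.map fun b => Polynomial.X - Polynomial.C b).prod := by
    refine ⟨f.reflect d, ?_⟩
    rw [← reflect_reciprocalPoly, ← reflect_reciprocalPoly, hmul, ← hdB,
      Polynomial.reflect_mul _ _ hfd (natDegree_reciprocalPoly_le A), mul_comm]
  rwa [Multiset.prod_X_sub_C_dvd_iff_le_roots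
    (Polynomial.monic_multisetProd_X_sub_C B).ne_zero,
    Polynomial.roots_multiset_prod_X_sub_C] at hdvd

/-- Let `Σ` be a set of `N` distinct complex numbers, `1 ≤ m ≤ N`, and `a₁, …, a_m ∈ Σ`
(repetitions allowed), `A` the multiset `{a₁,…,a_m}`.  Then the `aᵢ` are pairwise distinct iff
`h_k(A−Σ) = 0` for all `N + 1 − m ≤ k ≤ N`. -/
theorem distinct_iff_hMulSub_vanish (N m : ℕ) (hm : 1 ≤ m) (hmN : m ≤ N)
    (S : Finset ℂ) (hS : S.card = N) (a : Fin m → ℂ) (ha : ∀ i, a i ∈ S) :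
    Function.Injective a ↔
      ∀ k : ℕ, N + 1 - m ≤ k → k ≤ N →
        hMulSub (Multiset.map a Finset.univ.val) S.val k = 0 := by
  have hcard : Multiset.card (Multiset.map a Finset.univ.val) = m := by simp
  have hinj : Function.Injective a ↔ (Multiset.map a Finset.univ.val).Nodup :=
    ⟨fun h => Finset.univ.nodup.map h, fun h i j hij =>
      Multiset.inj_on_of_nodup_map h i (Finset.mem_univ i) j (Finset.mem_univ j) hij⟩
  have hle : (Multiset.map a Finset.univ.val).Nodup ↔ Multiset.map a Finset.univ.val ≤ S.val := by
    refine ⟨fun h => (Multiset.le_iff_subset h).mpr fun x hx => ?_,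
      fun h => Multiset.nodup_of_le h S.nodup⟩
    obtain ⟨i, -, rfl⟩ := Multiset.mem_map.mp hx
    exact ha i
  have hSN : Multiset.card S.val = N := hS
  rw [hinj, hle]
  refine ⟨fun h k hk _ => hMulSub_eq_zero_of_le h (by omega), fun h =>
    le_of_hMulSub_eq_zero (by omega) (by rwa [hcard, hSN])⟩
end

section
/- Let Σ be a set of N distinct complex numbers and 1 ≤ m ≤ N. Then: (a) every element g of the ideal I satisfies g(Ω) = 0 for every Ω ⊆ Σ with |Ω| = m, so that evaluation at Ω descends to a well-defined ℂ-algebra map Sym/I → ℂ; and (b) for every symmetric polynomial f ∈ Sym and every Ω ⊆ Σ with |Ω| = m, the polynomial f·Q_Ω − f(Ω)·Q_Ω lies in I. -/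
set_option synthInstance.maxHeartbeats 1000000
set_option maxHeartbeats 1000000

open MvPolynomial

lemma Q_isSymmetric (m : ℕ) (c : ℂ) (T : Finset ℂ) :
    MvPolynomial.IsSymmetric (C c * ∏ i : Fin m, ∏ r ∈ T, (X i - C r) : MvPolynomial (Fin m) ℂ) := by
  intro e
  simp only [map_mul, map_prod, map_sub, rename_X, rename_C]
  congr 1
  exact Equiv.prod_comp e fun i => ∏ r ∈ T, ((X i : MvPolynomial (Fin m) ℂ) - C r)

/-- The symmetric polynomial `Q_Ω`, as an element of the algebra of symmetric polynomials. -/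
noncomputable def QSym (m : ℕ) (S Ω : Finset ℂ) : symmetricSubalgebra (Fin m) ℂ :=
  ⟨C ((∏ s ∈ Ω, ∏ r ∈ S \ Ω, (s - r))⁻¹) * ∏ i : Fin m, ∏ r ∈ S \ Ω, (X i - C r),
   (mem_symmetricSubalgebra _).2 (Q_isSymmetric m _ _)⟩

namespace Polynomial

lemma natDegree_prod_X_sub_C_le {A ι : Type*} [CommRing A] (s : Finset ι) (a : ι → A) :
    (∏ i ∈ s, (X - C (a i))).natDegree ≤ s.card := by
  simpa using (natDegree_prod_le s _).trans
    (Finset.sum_le_card_nsmul s _ 1 fun j _ => natDegree_X_sub_C_le (a j))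

lemma reflect_prod_X_sub_C {A ι : Type*} [CommRing A] (s : Finset ι) (a : ι → A) :
    reflect s.card (∏ i ∈ s, (X - C (a i))) = ∏ i ∈ s, (1 - C (a i) * X) := by
  classical
  induction s using Finset.induction_on with
  | empty => simp
  | insert i s hi ih =>
    rw [Finset.card_insert_of_notMem hi, Finset.prod_insert hi, Finset.prod_insert hi, add_comm,
      reflect_mul _ _ (natDegree_X_sub_C_le _) (natDegree_prod_X_sub_C_le s a), ih]
    congr 1
    rw [sub_eq_add_neg, ← C_neg, reflect_add, reflect_one_X, reflect_C]
    simp [sub_eq_add_neg]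

lemma coeff_card_prod_X_sub_C {A ι : Type*} [CommRing A] (s : Finset ι) (a : ι → A) :
    (∏ i ∈ s, (X - C (a i))).coeff s.card = 1 := by
  nontriviality A
  have h := (monic_prod_X_sub_C a s).coeff_natDegree
  rwa [natDegree_finsetProd_X_sub_C_eq_card] at h

/-- A polynomial of degree less than `#s` vanishing at `#s` points with invertible differences is
zero. -/
lemma eq_zero_of_degree_lt_card_of_eval_eq_zero {A ι : Type*} [CommRing A] (s : Finset ι)
    (a : ι → A) (ha : ∀ i ∈ s, ∀ j ∈ s, i ≠ j → IsUnit (a i - a j)) {p : A[X]}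
    (hp : ∀ k, s.card ≤ k → p.coeff k = 0) (h : ∀ i ∈ s, p.eval (a i) = 0) : p = 0 := by
  nontriviality A
  by_contra hne
  refine (monic_prod_X_sub_C a s).not_dvd_of_degree_lt hne ?_ ?_
  · rw [degree_eq_natDegree (monic_prod_X_sub_C a s).ne_zero, natDegree_finsetProd_X_sub_C_eq_card]
    exact (degree_lt_iff_coeff_zero _ _).2 hp
  · refine Finset.prod_dvd_of_coprime (fun i hi j hj hij => ?_) fun i hi => dvd_iff_isRoot.2 (h i hi)
    exact isCoprime_X_sub_C_of_isUnit_sub (ha i hi j hj hij)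

/-- If the power series quotient of the reflections of `P` and `E` has `m` consecutive vanishing
coefficients ending in degree `N`, then `E` divides `P`. -/
lemma exists_mul_eq_of_coeff_eq_zero {A : Type*} [CommRing A] {m N : ℕ} (hmN : m ≤ N)
    {E P : A[X]} (hE : E.natDegree ≤ m) (hE1 : E.coeff m = 1) (hP : P.natDegree ≤ N)
    (hP1 : P.coeff N = 1) {G : PowerSeries A}
    (hG : (reflect m E : PowerSeries A) * G = (reflect N P : A[X]))
    (h0 : ∀ k ∈ Set.Icc (N + 1 - m) N, PowerSeries.coeff k G = 0) :
    ∃ H : A[X], H.natDegree ≤ N - m ∧ H.coeff (N - m) = 1 ∧ E * H = P := by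
  have hE' : (reflect m E).natDegree ≤ m := by
    simpa [hE] using natDegree_reflect_le (N := m) (p := E)
  have hP' : (reflect N P).natDegree ≤ N := by
    simpa [hP] using natDegree_reflect_le (N := N) (p := P)
  have hall : ∀ k, N + 1 - m ≤ k → PowerSeries.coeff k G = 0 := by
    intro k
    induction k using Nat.strong_induction_on with
    | _ k ih =>
      intro hk
      by_cases hkN : k ≤ N
      · exact h0 k ⟨hk, hkN⟩
      have h := congrArg (PowerSeries.coeff k) hG
      rw [PowerSeries.coeff_mul, Polynomial.coeff_coe,
        coeff_eq_zero_of_natDegree_lt (by omega : (reflect N P).natDegree < k),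
        Finset.sum_eq_single (0, k)] at h
      · simpa [coeff_reflect, hE1] using h
      · rintro ⟨i, j⟩ hij hne
        rw [Finset.HasAntidiagonal.mem_antidiagonal] at hij
        simp only [ne_eq, Prod.mk.injEq, not_and] at hij hne
        rw [Polynomial.coeff_coe]
        by_cases him : i ≤ m
        · rw [ih j (by omega) (by omega), mul_zero]
        · rw [coeff_eq_zero_of_natDegree_lt (by omega), zero_mul]
      · simp
  set T := PowerSeries.trunc (N - m + 1) G
  have hT : (T : PowerSeries A) = G := by
    ext k
    rw [Polynomial.coeff_coe, PowerSeries.coeff_trunc]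
    split_ifs with h
    · rfl
    · exact (hall k (by omega)).symm
  have hTd : T.natDegree ≤ N - m := natDegree_le_iff_coeff_eq_zero.2 fun k hk => by
    rw [PowerSeries.coeff_trunc, if_neg (by omega)]
  have hHd : (reflect (N - m) T).natDegree ≤ N - m := by
    simpa [hTd] using natDegree_reflect_le (N := N - m) (p := T)
  have hmul : E * reflect (N - m) T = P := by
    have h : reflect m E * T = reflect N P := by
      rw [← hT, ← Polynomial.coe_mul] at hG
      exact Polynomial.coe_injective A hG
    have h2 := reflect_mul _ _ hE' hTd
    rw [h, Nat.add_sub_cancel' hmN, reflect_reflect, reflect_reflect] at h2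
    exact h2.symm
  refine ⟨_, hHd, ?_, hmul⟩
  have h := coeff_mul_add_eq_of_natDegree_le hE hHd
  rwa [hmul, Nat.add_sub_cancel' hmN, hP1, hE1, one_mul, eq_comm] at h

/-- If `E` divides a product of linear factors over `s` and `q` is divisible by the values of `E`
at the points of `s \ t`, then modulo the annihilator of `q`, `E` is the product over `t`. -/
lemma mul_C_eq_prod_mul_C {A ι : Type*} [CommRing A] [DecidableEq ι] {s t : Finset ι} (hts : t ⊆ s)
    (a : ι → A) (ha : ∀ i ∈ s, ∀ j ∈ s, i ≠ j → IsUnit (a i - a j)) {E H : A[X]}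
    (hH : H.natDegree ≤ (s \ t).card) (hH1 : H.coeff (s \ t).card = 1)
    (hEH : E * H = ∏ i ∈ s, (X - C (a i))) {q : A} (hq : ∀ i ∈ s \ t, E.eval (a i) ∣ q) :
    E * C q = (∏ i ∈ t, (X - C (a i))) * C q := by
  have hsub : ∀ i ∈ s \ t, i ∈ s := fun i hi => (Finset.mem_sdiff.1 hi).1
  have key : (H - ∏ i ∈ s \ t, (X - C (a i))) * C q = 0 := by
    refine eq_zero_of_degree_lt_card_of_eval_eq_zero (s \ t) a
      (fun i hi j hj => ha i (hsub i hi) j (hsub j hj)) (fun k hk => ?_) fun i hi => ?_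
    · rw [coeff_mul_C, coeff_sub]
      rcases hk.eq_or_lt with rfl | hk
      · rw [hH1, coeff_card_prod_X_sub_C, sub_self, zero_mul]
      · rw [coeff_eq_zero_of_natDegree_lt (hH.trans_lt hk),
          coeff_eq_zero_of_natDegree_lt ((natDegree_prod_X_sub_C_le _ a).trans_lt hk), sub_zero,
          zero_mul]
    · obtain ⟨c, rfl⟩ := hq i hi
      have h1 : E.eval (a i) * H.eval (a i) = 0 := by
        rw [← eval_mul, hEH, eval_prod]
        exact Finset.prod_eq_zero (hsub i hi) (by simp)
      have h2 : (∏ j ∈ s \ t, (X - C (a j))).eval (a i) = 0 := by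
        rw [eval_prod]
        exact Finset.prod_eq_zero hi (by simp)
      rw [eval_mul, eval_sub, eval_C, h2]
      linear_combination c * h1
  refine (monic_prod_X_sub_C a (s \ t)).isRegular.left ?_
  have h3 := Finset.prod_sdiff hts (f := fun i => X - C (a i))
  simp only
  linear_combination -E * key + C q * hEH - C q * h3

end Polynomial

lemma PowerSeries.mk_pow_mul_one_sub {A : Type*} [CommRing A] (a : A) :
    (PowerSeries.mk fun n => a ^ n) * (1 - PowerSeries.C a * PowerSeries.X) = 1 := by
  have h := congrArg (PowerSeries.rescale a) (PowerSeries.mk_one_mul_one_sub_eq_one A)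
  simpa [PowerSeries.rescale_mk, PowerSeries.rescale_X] using h

lemma MvPolynomial.mk_hsymm_eq_prod (m : ℕ) :
    PowerSeries.mk (hsymm (Fin m) ℂ) =
      ∏ i : Fin m, PowerSeries.mk fun n => (X i : MvPolynomial (Fin m) ℂ) ^ n := by
  ext1 d
  rw [PowerSeries.coeff_mk, PowerSeries.coeff_prod, hsymm]
  refine Finset.sum_bij' (fun s _ => Multiset.toFinsupp s.1)
    (fun l hl => ⟨Finsupp.toMultiset l, ?_⟩) ?_ ?_ ?_ ?_ ?_
  · rw [Finset.mem_finsuppAntidiag] at hl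
    rw [Finsupp.card_toMultiset, Finsupp.sum_fintype _ _ (by simp)]
    exact hl.1
  · intro s _
    rw [Finset.mem_finsuppAntidiag]
    exact ⟨(Multiset.sum_count_eq_card fun _ _ => Finset.mem_univ _).trans s.2, Finset.subset_univ _⟩
  · intros; exact Finset.mem_univ _
  · intro s _; exact Subtype.ext (by simp)
  · intros; simp
  · intro s _
    rw [Finset.prod_multiset_map_count]
    simp only [PowerSeries.coeff_mk, Multiset.toFinsupp_apply]
    refine Finset.prod_subset (Finset.subset_univ _) fun i _ hi => ?_
    rw [Multiset.count_eq_zero_of_notMem (by simpa using hi), pow_zero]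

lemma MvPolynomial.prod_mul_mk_hsymm (m : ℕ) :
    (∏ i : Fin m, (1 - PowerSeries.C (X i : MvPolynomial (Fin m) ℂ) * PowerSeries.X)) *
      PowerSeries.mk (hsymm (Fin m) ℂ) = 1 := by
  rw [mk_hsymm_eq_prod, ← Finset.prod_mul_distrib]
  exact Finset.prod_eq_one fun i _ => by rw [mul_comm, PowerSeries.mk_pow_mul_one_sub]

lemma Polynomial.coeff_reflect_prod_X_sub_C {A : Type*} [CommRing A] (S : Finset A) (j : ℕ) :
    (reflect S.card (∏ r ∈ S, (X - C r))).coeff j = (-1) ^ j * S.val.esymm j := by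
  by_cases hj : j ≤ S.card
  · have h := Multiset.prod_X_sub_C_coeff S.val (Nat.sub_le S.card j)
    rw [Finset.card_val, Nat.sub_sub_self hj] at h
    rw [coeff_reflect, revAt_le hj, ← h]
    rfl
  · have h : S.val.esymm j = 0 := by
      rw [Multiset.esymm, Multiset.powersetCard_eq_empty _ (by simpa using hj)]
      simp
    rw [h, mul_zero, coeff_reflect, revAt_eq_self_of_lt (by omega),
      coeff_eq_zero_of_natDegree_lt ((natDegree_prod_X_sub_C_le S _).trans_lt (by omega))]

lemma prod_enumFinset {M : Type*} [CommMonoid M] {m : ℕ} {Ω : Finset ℂ} (hΩ : Ω.card = m)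
    (f : ℂ → M) : ∏ i, f (enumFinset m Ω i) = ∏ s ∈ Ω, f s := by
  obtain rfl : Ω.toList.length = m := by rw [Finset.length_toList, hΩ]
  rw [← Finset.prod_map_toList Ω, ← Fin.prod_univ_fun_getElem Ω.toList f]
  exact Finset.prod_congr rfl fun i _ => by
    rw [enumFinset, List.getD_eq_getElem _ _ i.2]

lemma exists_map_val_eq_prod_X_sub_C (m : ℕ) :
    ∃ E : Polynomial (symmetricSubalgebra (Fin m) ℂ),
      E.map (symmetricSubalgebra (Fin m) ℂ).val.toRingHom =
        ∏ i : Fin m, (Polynomial.X - Polynomial.C (X i)) := by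
  refine (Polynomial.mem_lifts _).1 ((Polynomial.lifts_iff_coeff_lifts _).2 fun n => ?_)
  suffices hsymm : (Polynomial.coeff (∏ i : Fin m, (Polynomial.X -
      Polynomial.C (X i : MvPolynomial (Fin m) ℂ))) n).IsSymmetric from
    ⟨⟨_, (mem_symmetricSubalgebra _).2 hsymm⟩, rfl⟩
  intro e
  have h : (∏ i : Fin m, (Polynomial.X - Polynomial.C (X i : MvPolynomial (Fin m) ℂ))).map
      (rename e).toRingHom = ∏ i : Fin m, (Polynomial.X - Polynomial.C (X i)) := by
    rw [Polynomial.map_prod]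
    simpa using Equiv.prod_comp e fun i =>
      (Polynomial.X - Polynomial.C (X i : MvPolynomial (Fin m) ℂ))
  conv_rhs => rw [← h]
  rw [Polynomial.coeff_map]
  rfl

section

variable {m : ℕ} {E : Polynomial (symmetricSubalgebra (Fin m) ℂ)}

lemma natDegree_le_of_map_val_eq (hE : E.map (symmetricSubalgebra (Fin m) ℂ).val.toRingHom =
    ∏ i : Fin m, (Polynomial.X - Polynomial.C (X i))) : E.natDegree ≤ m := by
  rw [← Polynomial.natDegree_map_eq_of_injective
    (f := (symmetricSubalgebra (Fin m) ℂ).val.toRingHom) Subtype.val_injective, hE]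
  simp

lemma coeff_of_map_val_eq (hE : E.map (symmetricSubalgebra (Fin m) ℂ).val.toRingHom =
    ∏ i : Fin m, (Polynomial.X - Polynomial.C (X i))) {k : ℕ} (hk : k ≤ m) :
    (E.coeff (m - k) : MvPolynomial (Fin m) ℂ) = (-1) ^ k * esymm (Fin m) ℂ k := by
  have h1 := congrArg (fun p => Polynomial.coeff p (m - k)) hE
  have h := Multiset.prod_X_sub_C_coeff
    ((Finset.univ : Finset (Fin m)).val.map (X : Fin m → MvPolynomial (Fin m) ℂ)) (k := m - k)
    (by simp)
  rw [Multiset.map_map, ← esymm_eq_multiset_esymm] at h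
  simp only [Multiset.card_map, Finset.card_val, Finset.card_univ, Fintype.card_fin,
    Nat.sub_sub_self hk] at h
  rw [← h]
  rw [Polynomial.coeff_map] at h1
  exact h1

lemma reflect_mul_mk_hXSElt (hE : E.map (symmetricSubalgebra (Fin m) ℂ).val.toRingHom =
    ∏ i : Fin m, (Polynomial.X - Polynomial.C (X i))) (S : Finset ℂ) :
    (E.reflect m : PowerSeries (symmetricSubalgebra (Fin m) ℂ)) *
      PowerSeries.mk (hXSElt m S.val) =
    (((∏ r ∈ S, (Polynomial.X - Polynomial.C r)).map (algebraMap ℂ _)).reflect S.card :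
      Polynomial (symmetricSubalgebra (Fin m) ℂ)) := by
  have hmk : (PowerSeries.mk (hXSElt m S.val)).map (symmetricSubalgebra (Fin m) ℂ).val.toRingHom =
      (((∏ r ∈ S, (Polynomial.X - Polynomial.C r)).map (algebraMap ℂ _)).reflect S.card :
        Polynomial (MvPolynomial (Fin m) ℂ)) * PowerSeries.mk (hsymm (Fin m) ℂ) := by
    ext1 k
    rw [PowerSeries.coeff_mul, Finset.Nat.sum_antidiagonal_eq_sum_range_succ_mk]
    simp only [PowerSeries.coeff_map, PowerSeries.coeff_mk, hXSElt, map_sum]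
    refine Finset.sum_congr rfl fun j _ => ?_
    rw [Polynomial.coeff_coe, Polynomial.reflect_map, Polynomial.coeff_map,
      Polynomial.coeff_reflect_prod_X_sub_C, ← Algebra.smul_def]
    rfl
  have hinj : Function.Injective
      (PowerSeries.map (symmetricSubalgebra (Fin m) ℂ).val.toRingHom) :=
    PowerSeries.map_injective _ Subtype.val_injective
  apply hinj
  have hprod := prod_mul_mk_hsymm m
  have href := Polynomial.reflect_prod_X_sub_C Finset.univ
    fun i : Fin m => (X i : MvPolynomial (Fin m) ℂ)
  rw [Finset.card_univ, Fintype.card_fin] at href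
  have hcoe : ((∏ i : Fin m, (1 - Polynomial.C (X i : MvPolynomial (Fin m) ℂ) * Polynomial.X) :
      Polynomial (MvPolynomial (Fin m) ℂ)) : PowerSeries (MvPolynomial (Fin m) ℂ)) =
      ∏ i : Fin m, (1 - PowerSeries.C (X i : MvPolynomial (Fin m) ℂ) * PowerSeries.X) := by
    rw [← Polynomial.coeToPowerSeries.ringHom_apply, map_prod]
    simp
  rw [map_mul, hmk, ← Polynomial.polynomial_map_coe, ← Polynomial.polynomial_map_coe,
    ← Polynomial.reflect_map, hE, href, hcoe, mul_left_comm, hprod, mul_one,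
    ← Polynomial.reflect_map, Polynomial.map_map]
  rfl

/-- Evaluation of symmetric polynomials at the enumeration of a finite set. -/
noncomputable def evalSym (m : ℕ) (Ω : Finset ℂ) : symmetricSubalgebra (Fin m) ℂ →ₐ[ℂ] ℂ :=
  (aeval (enumFinset m Ω)).comp (symmetricSubalgebra (Fin m) ℂ).val

lemma evalSym_apply (Ω : Finset ℂ) (f : symmetricSubalgebra (Fin m) ℂ) :
    evalSym m Ω f = eval (enumFinset m Ω) (f : MvPolynomial (Fin m) ℂ) := by
  simp [evalSym, aeval_eq_eval]

lemma map_evalSym_of_map_val_eq (hE : E.map (symmetricSubalgebra (Fin m) ℂ).val.toRingHom =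
    ∏ i : Fin m, (Polynomial.X - Polynomial.C (X i))) {Ω : Finset ℂ} (hΩ : Ω.card = m) :
    E.map (evalSym m Ω).toRingHom = ∏ s ∈ Ω, (Polynomial.X - Polynomial.C s) := by
  rw [← prod_enumFinset hΩ fun s => Polynomial.X - Polynomial.C s]
  have h := congrArg (Polynomial.map (aeval (enumFinset m Ω)).toRingHom) hE
  rw [Polynomial.map_map, Polynomial.map_prod] at h
  refine Eq.trans ?_ (h.trans ?_)
  · rfl
  · simp

lemma evalSym_hXSElt_eq_zero {S Ω : Finset ℂ} (hS : Ω ⊆ S) (hΩ : Ω.card = m) {k : ℕ}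
    (hk : S.card + 1 - m ≤ k) : evalSym m Ω (hXSElt m S.val k) = 0 := by
  obtain ⟨E, hE⟩ := exists_map_val_eq_prod_X_sub_C m
  have h := congrArg (PowerSeries.map (evalSym m Ω).toRingHom) (reflect_mul_mk_hXSElt hE S)
  have hcard := Finset.card_sdiff_add_card_eq_card hS
  have hid : (evalSym m Ω).toRingHom.comp (algebraMap ℂ _) = RingHom.id ℂ :=
    (evalSym m Ω).comp_algebraMap
  rw [map_mul, ← Polynomial.polynomial_map_coe, ← Polynomial.polynomial_map_coe,
    ← Polynomial.reflect_map, map_evalSym_of_map_val_eq hE hΩ, ← Polynomial.reflect_map,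
    Polynomial.map_map, hid, Polynomial.map_id, ← Finset.prod_sdiff hS, mul_comm (∏ _ ∈ _, _),
    ← hcard, add_comm (S \ Ω).card,
    Polynomial.reflect_mul _ _ (Polynomial.natDegree_prod_X_sub_C_le Ω _)
      (Polynomial.natDegree_prod_X_sub_C_le (S \ Ω) _), Polynomial.coe_mul, hΩ] at h
  have h2 := mul_left_cancel₀ (by
    rw [Ne, Polynomial.coe_eq_zero_iff, Polynomial.reflect_eq_zero_iff]
    exact (Polynomial.monic_prod_X_sub_C _ _).ne_zero) h
  have h3 := congrArg (PowerSeries.coeff k) h2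
  rw [PowerSeries.coeff_map, PowerSeries.coeff_mk, Polynomial.coeff_coe,
    Polynomial.coeff_eq_zero_of_natDegree_lt] at h3
  · exact h3
  · refine Polynomial.natDegree_reflect_le.trans_lt ?_
    have := Polynomial.natDegree_prod_X_sub_C_le (S \ Ω) fun r => r
    omega

lemma eval_dvd_QSym (hE : E.map (symmetricSubalgebra (Fin m) ℂ).val.toRingHom =
    ∏ i : Fin m, (Polynomial.X - Polynomial.C (X i))) (S Ω : Finset ℂ) {r : ℂ} (hr : r ∈ S \ Ω) :
    E.eval (algebraMap ℂ _ r) ∣ QSym m S Ω := by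
  have hev : ∀ t : ℂ, ((E.eval (algebraMap ℂ _ t) : symmetricSubalgebra (Fin m) ℂ) :
      MvPolynomial (Fin m) ℂ) = ∏ i : Fin m, (C t - X i) := by
    intro t
    have h := congrArg (Polynomial.eval (C t)) hE
    rw [Polynomial.eval_prod] at h
    simp only [Polynomial.eval_sub, Polynomial.eval_X, Polynomial.eval_C] at h
    rw [← h, ← Polynomial.eval₂_eq_eval_map]
    exact Polynomial.hom_eval₂ E (RingHom.id _) (symmetricSubalgebra (Fin m) ℂ).val.toRingHom _
  have hQ : QSym m S Ω =
      algebraMap ℂ _ ((∏ s ∈ Ω, ∏ r ∈ S \ Ω, (s - r))⁻¹) *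
        ∏ t ∈ S \ Ω, ((-1) ^ m * E.eval (algebraMap ℂ _ t)) := by
    apply Subtype.ext
    simp only [QSym, MulMemClass.coe_mul, SubmonoidClass.coe_finsetProd, SubmonoidClass.coe_pow,
      hev]
    refine congrArg₂ (· * ·) rfl (Finset.prod_comm.trans (Finset.prod_congr rfl fun t _ => ?_))
    have hneg : ∏ i : Fin m, (X i - C t : MvPolynomial (Fin m) ℂ) =
        (-1) ^ m * ∏ i : Fin m, (C t - X i) := by
      rw [← Finset.card_fin m, ← Finset.prod_const, Finset.card_fin, ← Finset.prod_mul_distrib]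
      exact Finset.prod_congr rfl fun i _ => by ring
    simpa using hneg
  rw [hQ]
  refine Dvd.dvd.mul_left (Dvd.dvd.trans ?_ (Finset.dvd_prod_of_mem _ hr)) _
  exact dvd_mul_left _ _

end

/-- In any algebra over the symmetric polynomials in which `h_{N+1-m}(X-Σ), …, h_N(X-Σ)` vanish,
multiplication by `f` acts on `Q_Ω` as the scalar `f(Ω)`. -/
lemma map_mul_map_QSym {m : ℕ} {S Ω : Finset ℂ} (hS : Ω ⊆ S) (hΩ : Ω.card = m)
    {A : Type*} [CommRing A] [Algebra ℂ A] {π : symmetricSubalgebra (Fin m) ℂ →ₐ[ℂ] A}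
    (hπ : ∀ k ∈ Set.Icc (S.card + 1 - m) S.card, π (hXSElt m S.val k) = 0)
    (f : symmetricSubalgebra (Fin m) ℂ) :
    π f * π (QSym m S Ω) =
      algebraMap ℂ _ (evalSym m Ω f) * π (QSym m S Ω) := by
  obtain ⟨E, hE⟩ := exists_map_val_eq_prod_X_sub_C m
  have hmN : m ≤ S.card := hΩ ▸ Finset.card_le_card hS
  have hcard : (S \ Ω).card = S.card - m := by rw [Finset.card_sdiff_of_subset hS, hΩ]
  have hEm : E.coeff m = 1 := Subtype.ext (by simpa using coeff_of_map_val_eq hE (Nat.zero_le m))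
  have hprod : ∀ T : Finset ℂ, (∏ r ∈ T, (Polynomial.X - Polynomial.C r)).map
      (algebraMap ℂ A) =
      ∏ r ∈ T, (Polynomial.X - Polynomial.C (algebraMap ℂ _ r)) := by
    intro T
    simp [Polynomial.map_prod]
  have hgf := congrArg (PowerSeries.map π.toRingHom) (reflect_mul_mk_hXSElt hE S)
  have hcomp : π.toRingHom.comp (algebraMap ℂ (symmetricSubalgebra (Fin m) ℂ)) =
    algebraMap ℂ A := π.comp_algebraMap
  rw [map_mul, ← Polynomial.polynomial_map_coe, ← Polynomial.polynomial_map_coe,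
    ← Polynomial.reflect_map, ← Polynomial.reflect_map, Polynomial.map_map, hcomp, hprod] at hgf
  obtain ⟨H, hH, hH1, hEH⟩ := Polynomial.exists_mul_eq_of_coeff_eq_zero hmN
    (Polynomial.natDegree_map_le.trans (natDegree_le_of_map_val_eq hE))
    (by rw [Polynomial.coeff_map, hEm, map_one]) (Polynomial.natDegree_prod_X_sub_C_le S _)
    (Polynomial.coeff_card_prod_X_sub_C S _) hgf fun k hk => by
      rw [PowerSeries.coeff_map, PowerSeries.coeff_mk]
      exact hπ k hk
  have key := Polynomial.mul_C_eq_prod_mul_C hS _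
    (fun r _ s _ hrs => by
      rw [← map_sub]
      exact (sub_ne_zero.2 hrs).isUnit.map (algebraMap ℂ _))
    (hcard ▸ hH) (hcard ▸ hH1) hEH (q := π (QSym m S Ω)) fun r hr => by
      have h := map_dvd π (eval_dvd_QSym hE S Ω hr)
      have h2 := Polynomial.eval_map_apply (p := E) π.toRingHom (algebraMap ℂ _ r)
      rw [← AlgHom.commutes π r]
      exact h2 ▸ h
  rw [← hprod, ← map_evalSym_of_map_val_eq hE hΩ] at key
  have hcoeff : ∀ k, π (E.coeff k) * π (QSym m S Ω) =
      algebraMap ℂ _ (evalSym m Ω (E.coeff k)) * π (QSym m S Ω) := by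
    intro k
    have h := congrArg (fun p => Polynomial.coeff p k) key
    simp only [Polynomial.coeff_mul_C, Polynomial.coeff_map] at h
    exact h
  obtain ⟨p, rfl⟩ := esymmAlgHom_fin_surjective ℂ le_rfl f
  induction p using MvPolynomial.induction_on with
  | C c =>
    rw [← algebraMap_eq, AlgHom.commutes, AlgHom.commutes, AlgHom.commutes]
    rfl
  | add p q hp hq => simp only [map_add, add_mul, hp, hq]
  | mul_X p i hp =>
    have hi : esymmAlgHom (Fin m) ℂ m (X i) =
        (-1) ^ (i.1 + 1) * E.coeff (m - (i.1 + 1)) := by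
      apply Subtype.ext
      rw [MulMemClass.coe_mul, coeff_of_map_val_eq hE i.2, ← mul_assoc]
      simp [esymmAlgHom, ← mul_pow]
    rw [map_mul, hi]
    simp only [map_mul, map_pow, map_neg, map_one]
    linear_combination (-1) ^ (i.1 + 1) * π (esymmAlgHom (Fin m) ℂ m p) *
      hcoeff (m - (i.1 + 1)) + (-1) ^ (i.1 + 1) *
        algebraMap ℂ _ (evalSym m Ω (E.coeff (m - (i.1 + 1)))) * hp

lemma Ideal.exists_algHom_eq_zero_iff_mem.{u, v} {k : Type u} {R : Type v} [CommRing k] [CommRing R]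
    [Algebra k R] (I : Ideal R) : ∃ (A : Type v) (_ : CommRing A) (_ : Algebra k A)
      (π : R →ₐ[k] A), ∀ x, π x = 0 ↔ x ∈ I :=
  ⟨R ⧸ I, inferInstance, inferInstance, Ideal.Quotient.mkₐ k I,
    fun _ => Ideal.Quotient.eq_zero_iff_mem⟩

/-- (a) Every `g` in the ideal `I = (h_{N+1−m}(X−Σ), …, h_N(X−Σ))` of the ring of symmetric
polynomials vanishes when evaluated at any `Ω ⊆ Σ` with `|Ω| = m`, so evaluation at `Ω` descends
to a `ℂ`-algebra map `Sym/I → ℂ`; (b) for every symmetric `f` and every such `Ω`,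
`f·Q_Ω − f(Ω)·Q_Ω ∈ I`. -/
theorem eval_descends_and_multiplication_by_Q (N m : ℕ) (hm : 1 ≤ m) (hmN : m ≤ N)
    (S : Finset ℂ) (hS : S.card = N) :
    (∀ Ω : Finset ℂ, Ω ⊆ S → Ω.card = m →
      (∀ g ∈ Ideal.span ((fun k => hXSElt m S.val k) '' Set.Icc (N + 1 - m) N),
        eval (enumFinset m Ω) (g : MvPolynomial (Fin m) ℂ) = 0) ∧
      ∃ φ : (symmetricSubalgebra (Fin m) ℂ ⧸
          Ideal.span ((fun k => hXSElt m S.val k) '' Set.Icc (N + 1 - m) N)) →ₐ[ℂ] ℂ,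
        ∀ f : symmetricSubalgebra (Fin m) ℂ,
          φ (Ideal.Quotient.mk
              (Ideal.span ((fun k => hXSElt m S.val k) '' Set.Icc (N + 1 - m) N)) f)
            = eval (enumFinset m Ω) (f : MvPolynomial (Fin m) ℂ)) ∧
    (∀ f : symmetricSubalgebra (Fin m) ℂ, ∀ Ω : Finset ℂ, Ω ⊆ S → Ω.card = m →
      f * QSym m S Ω - eval (enumFinset m Ω) (f : MvPolynomial (Fin m) ℂ) • QSym m S Ω ∈
        Ideal.span ((fun k => hXSElt m S.val k) '' Set.Icc (N + 1 - m) N)) := by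
  subst hS
  refine ⟨fun Ω hΩS hΩ => ?_, fun f Ω hΩS hΩ => ?_⟩
  · have hle : Ideal.span ((fun k => hXSElt m S.val k) '' Set.Icc (S.card + 1 - m) S.card) ≤
        RingHom.ker (evalSym m Ω) := by
      rw [Ideal.span_le]
      rintro _ ⟨k, hk, rfl⟩
      exact evalSym_hXSElt_eq_zero hΩS hΩ hk.1
    exact ⟨fun g hg => evalSym_apply Ω g ▸ hle hg,
      Ideal.Quotient.liftₐ _ (evalSym m Ω) fun g hg => hle hg, evalSym_apply Ω⟩
  · obtain ⟨A, _, _, π, hπ⟩ := Ideal.exists_algHom_eq_zero_iff_mem (k := ℂ) (Ideal.span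
      ((fun k => hXSElt m S.val k) '' Set.Icc (S.card + 1 - m) S.card))
    have h := map_mul_map_QSym hΩS hΩ (π := π)
      (fun k hk => (hπ _).2 (Ideal.subset_span ⟨k, hk, rfl⟩)) f
    rw [← hπ, map_sub, map_mul, h, ← evalSym_apply, map_smul, Algebra.smul_def, sub_self]
end

section
/- Let a, b ≥ 0 and work in ℂ[x₁,…,x_a,y₁,…,y_b]. Then for every integer k > b, the identity h_k(X−Y) = Σ_{j=1}^{a} (−1)^{j−1} e_j(X)·h_{k−j}(X−Y) holds. -/
open MvPolynomial

/-- `h_k(X−Y) := ∑_{j=0}^{k} (−1)^j e_j(Y)·h_{k−j}(X)` in `ℂ[x₁,…,x_a,y₁,…,y_b]`,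
extended by `0` for negative indices `k : ℤ`. -/
noncomputable def hXYZ (a b : ℕ) (k : ℤ) : MvPolynomial (Fin a ⊕ Fin b) ℂ :=
  if 0 ≤ k then
    ∑ j ∈ Finset.range (k.toNat + 1),
      ((-1 : ℂ) ^ j) •
        (rename Sum.inr (esymm (Fin b) ℂ j) * rename Sum.inl (hsymm (Fin a) ℂ (k.toNat - j)))
  else 0

namespace MvPolynomial

section GeneratingSeries

variable {σ R : Type*} [Fintype σ] [CommRing R]

theorem esymm_eq_zero_of_card_lt {n : ℕ} (h : Fintype.card σ < n) : esymm σ R n = 0 := by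
  rw [esymm, Finset.powersetCard_eq_empty.mpr (by simpa using h), Finset.sum_empty]

/-- The generating series of the signed elementary symmetric polynomials. -/
theorem mk_neg_one_pow_mul_esymm :
    PowerSeries.mk (fun n => (-1) ^ n * esymm σ R n) =
      ∏ i : σ, (1 - PowerSeries.C (X i : MvPolynomial σ R) * PowerSeries.X) := by
  ext1 n
  simp_rw [sub_eq_add_neg]
  rw [Finset.prod_one_add, map_sum, PowerSeries.coeff_mk, esymm, Finset.powersetCard_eq_filter,
    Finset.sum_filter, Finset.mul_sum]
  refine Finset.sum_congr rfl fun t _ => ?_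
  rw [Finset.prod_neg, Finset.prod_mul_distrib, Finset.prod_const, ← map_prod,
    ← map_one (PowerSeries.C (R := MvPolynomial σ R)), ← map_neg, ← map_pow, ← mul_assoc,
    ← map_mul, PowerSeries.coeff_C_mul_X_pow]
  simp only [eq_comm (a := n)]
  split_ifs with h
  · rw [h]
  · rw [mul_zero]

variable [DecidableEq σ]

theorem hsymm_eq_sum_finsuppAntidiag_s13 (n : ℕ) :
    hsymm σ R n = ∑ l ∈ Finset.finsuppAntidiag Finset.univ n, ∏ i : σ, X i ^ l i := by
  rw [hsymm]
  refine Finset.sum_bij (fun s _ => Multiset.toFinsupp s.1) ?_ ?_ ?_ ?_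
  · rintro s -
    refine Finset.mem_finsuppAntidiag'.mpr ⟨?_, Finset.subset_univ _⟩
    exact (Multiset.toFinsupp_sum_eq s.1).trans s.2
  · intro s _ t _ h
    exact Subtype.ext (Multiset.toFinsupp.injective h)
  · intro l hl
    refine ⟨⟨Finsupp.toMultiset l, ?_⟩, Finset.mem_univ _, by simp⟩
    rw [Finsupp.card_toMultiset]
    exact (Finset.mem_finsuppAntidiag'.mp hl).1
  · rintro s -
    rw [Finset.prod_multiset_map_count]
    exact Finset.prod_subset (Finset.subset_univ _) fun i _ hi => by simp_all

/-- The generating series of the complete homogeneous symmetric polynomials. -/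
theorem mk_hsymm :
    PowerSeries.mk (hsymm σ R) =
      ∏ i : σ, PowerSeries.mk fun n => (X i : MvPolynomial σ R) ^ n := by
  ext1 n
  simp [PowerSeries.coeff_prod, hsymm_eq_sum_finsuppAntidiag_s13]

theorem mk_neg_one_pow_mul_esymm_mul_mk_hsymm :
    PowerSeries.mk (fun n => (-1) ^ n * esymm σ R n) * PowerSeries.mk (hsymm σ R) = 1 := by
  rw [mk_neg_one_pow_mul_esymm, mk_hsymm, ← Finset.prod_mul_distrib]
  refine Finset.prod_eq_one fun i _ => ?_
  ext1 n
  rw [sub_mul, one_mul, mul_assoc, map_sub, PowerSeries.coeff_C_mul]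
  cases n with
  | zero => simp
  | succ n => simp [PowerSeries.coeff_succ_X_mul, PowerSeries.coeff_one, pow_succ']

end GeneratingSeries

end MvPolynomial

theorem hXYZ_of_neg (a b : ℕ) {k : ℤ} (hk : k < 0) : hXYZ a b k = 0 :=
  if_neg hk.not_ge

theorem mk_hXYZ (a b : ℕ) :
    PowerSeries.mk (fun n : ℕ => hXYZ a b n) =
      PowerSeries.map (rename Sum.inr).toRingHom
          (PowerSeries.mk fun n => (-1) ^ n * esymm (Fin b) ℂ n) *
        PowerSeries.map (rename Sum.inl).toRingHom (PowerSeries.mk (hsymm (Fin a) ℂ)) := by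
  ext1 n
  rw [PowerSeries.coeff_mul, Finset.Nat.sum_antidiagonal_eq_sum_range_succ_mk]
  simp [hXYZ, smul_eq_C_mul, mul_assoc]

theorem sum_esymm_mul_hXYZ (a b n : ℕ) (hn : b < n) :
    ∑ j ∈ Finset.range (n + 1),
      (-1) ^ j * rename Sum.inl (esymm (Fin a) ℂ j) * hXYZ a b ((n : ℤ) - j) = 0 := by
  have h : PowerSeries.map (rename Sum.inl).toRingHom
        (PowerSeries.mk fun n => (-1) ^ n * esymm (Fin a) ℂ n) *
      PowerSeries.mk (fun n : ℕ => hXYZ a b n) =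
      PowerSeries.map (rename Sum.inr).toRingHom
        (PowerSeries.mk fun n => (-1) ^ n * esymm (Fin b) ℂ n) := by
    rw [mk_hXYZ, mul_left_comm, ← map_mul, mk_neg_one_pow_mul_esymm_mul_mk_hsymm, map_one, mul_one]
  have hc := congrArg (PowerSeries.coeff n) h
  rw [PowerSeries.coeff_mul, Finset.Nat.sum_antidiagonal_eq_sum_range_succ_mk,
    PowerSeries.coeff_map, PowerSeries.coeff_mk, esymm_eq_zero_of_card_lt (by simpa using hn),
    mul_zero, map_zero] at hc
  rw [← hc]
  refine Finset.sum_congr rfl fun j hj => ?_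
  simp [Nat.cast_sub (Finset.mem_range_succ_iff.mp hj)]

/-- For every integer `k > b`,
`h_k(X−Y) = ∑_{j=1}^{a} (−1)^{j−1} e_j(X)·h_{k−j}(X−Y)` in `ℂ[x₁,…,x_a,y₁,…,y_b]`. -/
theorem hXY_recursion (a b : ℕ) (k : ℤ) (hk : (b : ℤ) < k) :
    hXYZ a b k
      = ∑ j ∈ Finset.Icc 1 a,
          ((-1 : ℂ) ^ (j - 1)) •
            (rename Sum.inl (esymm (Fin a) ℂ j) * hXYZ a b (k - (j : ℤ))) := by
  lift k to ℕ using by lia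
  have h := sum_esymm_mul_hXYZ a b k (by exact_mod_cast hk)
  rw [Finset.sum_subset (Finset.range_subset_range.mpr (show k + 1 ≤ k + a + 1 by lia))
      fun j _ hj => by
        rw [hXYZ_of_neg a b (by simp at hj; lia), mul_zero],
    ← Finset.sum_subset (Finset.range_subset_range.mpr (show a + 1 ≤ k + a + 1 by lia))
      fun j _ hj => by
        rw [esymm_eq_zero_of_card_lt (by simp at hj ⊢; lia), map_zero, mul_zero, zero_mul],
    Finset.sum_range_succ'] at h
  rw [← Finset.Ico_add_one_right_eq_Icc, Finset.sum_Ico_eq_sum_range, Nat.add_sub_cancel,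
    ← sub_eq_zero, ← h, sub_eq_add_neg, add_comm, ← Finset.sum_neg_distrib]
  congr 1
  · refine Finset.sum_congr rfl fun j _ => ?_
    rw [add_comm 1 j, Nat.add_sub_cancel, smul_eq_C_mul, pow_succ]
    simp [mul_assoc]
  · simp
end
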